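/- arXiv:1211.0044 — 4 statements merged into one kernel-verified Lean document; each statement's English description precedes it below -/
import Mathlib

section
/- If ζ(1/2 + it₀) ≠ 0 for a real number t₀, then the function t ↦ ζ(1/2 + it) is injective on some open interval containing t₀. -/
open Complex

/-- Fourth-order Euler–Maclaurin formula on the unit interval, with an error bound. -/
lemma norm_sub_eulerMaclaurin_le {F f f₁ f₂ f₃ f₄ : ℝ → ℂ} {M : ℝ}
    (hF : ∀ u ∈ Set.Icc (0 : ℝ) 1, HasDerivAt F (f u) u)
    (hf : ∀ u ∈ Set.Icc (0 : ℝ) 1, HasDerivAt f (f₁ u) u)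
    (hf₁ : ∀ u ∈ Set.Icc (0 : ℝ) 1, HasDerivAt f₁ (f₂ u) u)
    (hf₂ : ∀ u ∈ Set.Icc (0 : ℝ) 1, HasDerivAt f₂ (f₃ u) u)
    (hf₃ : ∀ u ∈ Set.Icc (0 : ℝ) 1, HasDerivAt f₃ (f₄ u) u)
    (hf₄ : ContinuousOn f₄ (Set.Icc 0 1)) (hM : ∀ u ∈ Set.Icc (0 : ℝ) 1, ‖f₄ u‖ ≤ M) :
    ‖F 1 - F 0 - (f 0 + f 1) / 2 + (f₁ 1 - f₁ 0) / 12‖ ≤ M / 720 := by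
  have h01 : Set.uIcc (0 : ℝ) 1 = Set.Icc 0 1 := Set.uIcc_of_le zero_le_one
  have key : ∫ u in (0 : ℝ)..1, ((u ^ 2 - 2 * u ^ 3 + u ^ 4 : ℝ) : ℂ) * f₄ u =
      24 * (F 1 - F 0 - (f 0 + f 1) / 2 + (f₁ 1 - f₁ 0) / 12) := by
    have := intervalIntegral.integral_eq_sub_of_hasDerivAt (a := 0) (b := 1)
      (f := fun u : ℝ => ((u ^ 2 - 2 * u ^ 3 + u ^ 4 : ℝ) : ℂ) * f₃ u
        - ((2 * u - 6 * u ^ 2 + 4 * u ^ 3 : ℝ) : ℂ) * f₂ u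
        + ((2 - 12 * u + 12 * u ^ 2 : ℝ) : ℂ) * f₁ u - ((-12 + 24 * u : ℝ) : ℂ) * f u + 24 * F u)
      (f' := fun u : ℝ => ((u ^ 2 - 2 * u ^ 3 + u ^ 4 : ℝ) : ℂ) * f₄ u) ?_ ?_
    · rw [this]
      push_cast
      ring
    · intro u hu
      rw [h01] at hu
      have e1 : HasDerivAt (fun u : ℝ => u ^ 2 - 2 * u ^ 3 + u ^ 4) (2 * u - 6 * u ^ 2 + 4 * u ^ 3) u := by
        refine ((((hasDerivAt_id' u).pow 2).sub (((hasDerivAt_id' u).pow 3).const_mul 2)).add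
          ((hasDerivAt_id' u).pow 4)).congr_deriv ?_
        norm_num; ring
      have e2 : HasDerivAt (fun u : ℝ => 2 * u - 6 * u ^ 2 + 4 * u ^ 3) (2 - 12 * u + 12 * u ^ 2) u := by
        refine ((((hasDerivAt_id' u).const_mul 2).sub (((hasDerivAt_id' u).pow 2).const_mul 6)).add
          (((hasDerivAt_id' u).pow 3).const_mul 4)).congr_deriv ?_
        norm_num; ring
      have e3 : HasDerivAt (fun u : ℝ => 2 - 12 * u + 12 * u ^ 2) (-12 + 24 * u) u := by
        refine ((((hasDerivAt_id' u).const_mul 12).const_sub 2).add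
          (((hasDerivAt_id' u).pow 2).const_mul 12)).congr_deriv ?_
        norm_num; ring
      have e4 : HasDerivAt (fun u : ℝ => -12 + 24 * u) 24 u := by
        refine (((hasDerivAt_id' u).const_mul 24).const_add (-12)).congr_deriv ?_
        norm_num
      refine (((((e1.ofReal_comp.mul (hf₃ u hu)).sub (e2.ofReal_comp.mul (hf₂ u hu))).add
        (e3.ofReal_comp.mul (hf₁ u hu))).sub (e4.ofReal_comp.mul (hf u hu))).add
        ((hF u hu).const_mul 24)).congr_deriv ?_
      push_cast
      ring
    · refine ContinuousOn.intervalIntegrable ?_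
      rw [h01]
      exact (by fun_prop : Continuous fun u : ℝ => ((u ^ 2 - 2 * u ^ 3 + u ^ 4 : ℝ) : ℂ)).continuousOn.mul hf₄
  have bound : ‖∫ u in (0 : ℝ)..1, ((u ^ 2 - 2 * u ^ 3 + u ^ 4 : ℝ) : ℂ) * f₄ u‖ ≤
      ∫ u in (0 : ℝ)..1, (u ^ 2 - 2 * u ^ 3 + u ^ 4) * M := by
    refine intervalIntegral.norm_integral_le_of_norm_le zero_le_one (.of_forall fun u hu => ?_)
      (Continuous.intervalIntegrable (by fun_prop) _ _)
    have hpos : 0 ≤ u ^ 2 - 2 * u ^ 3 + u ^ 4 := by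
      have : u ^ 2 - 2 * u ^ 3 + u ^ 4 = (u * (1 - u)) ^ 2 := by ring
      rw [this]; positivity
    rw [norm_mul, Complex.norm_real, Real.norm_of_nonneg hpos]
    exact mul_le_mul_of_nonneg_left (hM u ⟨hu.1.le, hu.2⟩) hpos
  have eval : ∫ u in (0 : ℝ)..1, (u ^ 2 - 2 * u ^ 3 + u ^ 4) * M = M / 30 := by
    rw [intervalIntegral.integral_mul_const, intervalIntegral.integral_add, intervalIntegral.integral_sub,
      intervalIntegral.integral_const_mul, integral_pow, integral_pow, integral_pow]
    · norm_num; ring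
    all_goals exact (by fun_prop : Continuous _).intervalIntegrable _ _
  rw [key, eval, norm_mul] at bound
  norm_num at bound ⊢
  linarith

lemma norm_GammaSeq_le {z : ℂ} (hz : 0 < z.re) {n : ℕ} (hn : n ≠ 0) :
    ‖GammaSeq z n‖ ≤ Real.Gamma z.re := by
  have h1 : Real.log (Real.GammaSeq z.re n) ≤ Real.log (Real.Gamma z.re) := by
    have := Real.BohrMollerup.ge_logGammaSeq Real.convexOn_log_Gamma (x := z.re) (n := n)
      (fun {y} hy => by
        simp only [Function.comp_apply, Real.Gamma_add_one hy.ne']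
        rw [Real.log_mul hy.ne' (Real.Gamma_pos_of_pos hy).ne', add_comm]) hz hn
    simp only [Function.comp_apply, Real.Gamma_one, Real.log_one, zero_add] at this
    refine le_trans (le_of_eq ?_) this
    have hn' : (0 : ℝ) < n := by positivity
    rw [Real.GammaSeq, Real.BohrMollerup.logGammaSeq, Real.log_div, Real.log_mul, Real.log_rpow hn',
      Real.log_prod]
    · intro i _; positivity
    · positivity
    · positivity
    · positivity
    · exact Finset.prod_ne_zero_iff.2 fun i _ => by positivity
  have hpos : 0 < Real.GammaSeq z.re n := by
    have hn' : (0 : ℝ) < n := by positivity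
    exact div_pos (by positivity) (Finset.prod_pos fun i _ => by positivity)
  refine le_trans ?_ ((Real.log_le_log_iff hpos (Real.Gamma_pos_of_pos hz)).1 h1)
  rw [GammaSeq, Real.GammaSeq, norm_div, norm_mul, norm_prod, norm_natCast_cpow_of_pos (by omega)]
  simp only [Complex.norm_natCast]
  have : ∀ j : ℕ, z.re + j ≤ ‖z + j‖ := fun j => by
    simpa using Complex.re_le_norm (z + j)
  gcongr with j
  exact this j

lemma add_natCast_ne_zero {z : ℂ} (hz : 0 < z.re) (j : ℕ) : z + j ≠ 0 := fun h => by
  have := congrArg Complex.re h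
  simp at this
  have : (0 : ℝ) ≤ j := by positivity
  linarith

lemma logDeriv_GammaSeq {z : ℂ} (hz : 0 < z.re) {n : ℕ} (hn : n ≠ 0) :
    logDeriv (fun w => GammaSeq w n) z =
      (Real.log n : ℂ) - ∑ k ∈ Finset.range (n + 1), 1 / (z + k) := by
  have hn' : (n : ℂ) ≠ 0 := by exact_mod_cast hn
  have hd : HasDerivAt (fun w : ℂ => (n : ℂ) ^ w * (n.factorial : ℂ))
      ((n : ℂ) ^ z * Complex.log n * 1 * n.factorial) z :=
    ((hasDerivAt_id' z).const_cpow (Or.inl hn')).mul_const _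
  unfold GammaSeq
  rw [logDeriv_div z, logDeriv_prod, logDeriv_apply, hd.deriv]
  · congr 1
    · rw [← Complex.natCast_log]
      have : (n : ℂ) ^ z ≠ 0 := by simp [Complex.cpow_eq_zero_iff, hn']
      have : (n.factorial : ℂ) ≠ 0 := by exact_mod_cast n.factorial_ne_zero
      field_simp
    · refine Finset.sum_congr rfl fun k _ => ?_
      rw [logDeriv_apply]
      simp
  · exact fun i _ => add_natCast_ne_zero hz i
  · exact fun i _ => by fun_prop
  · have : (n : ℂ) ^ z ≠ 0 := by simp [Complex.cpow_eq_zero_iff, hn']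
    have : (n.factorial : ℂ) ≠ 0 := by exact_mod_cast n.factorial_ne_zero
    positivity
  · exact Finset.prod_ne_zero_iff.2 fun i _ => add_natCast_ne_zero hz i
  · exact hd.differentiableAt
  · fun_prop

lemma differentiableAt_GammaSeq {z : ℂ} (hz : 0 < z.re) {n : ℕ} (hn : n ≠ 0) :
    DifferentiableAt ℂ (fun w => GammaSeq w n) z := by
  have hn' : (n : ℂ) ≠ 0 := by exact_mod_cast hn
  unfold GammaSeq
  refine DifferentiableAt.div ?_ (by fun_prop)
    (Finset.prod_ne_zero_iff.2 fun i _ => add_natCast_ne_zero hz i)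
  exact (((hasDerivAt_id' z).const_cpow (Or.inl hn')).mul_const _).differentiableAt

lemma tendsto_deriv_GammaSeq {z : ℂ} (hz : 0 < z.re) :
    Filter.Tendsto (fun n : ℕ => deriv (fun w => GammaSeq w n) z) Filter.atTop
      (nhds (deriv Gamma z)) := by
  set r := z.re / 2 with hr
  have hr0 : 0 < r := by positivity
  have hre : ∀ w ∈ Metric.closedBall z r, 0 < w.re := fun w hw => by
    have h1 := (Complex.abs_re_le_norm (w - z)).trans (by simpa [dist_eq_norm] using hw)
    have := (abs_le.1 h1).1
    simp at this
    linarith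
  have hball : Metric.ball z r ⊆ Metric.closedBall z r := Metric.ball_subset_closedBall
  have hU : IsOpen {w : ℂ | 0 < w.re} := isOpen_lt continuous_const Complex.continuous_re
  have cauchy : ∀ f : ℂ → ℂ, DifferentiableOn ℂ f {w : ℂ | 0 < w.re} →
      deriv f z = (2 * Real.pi * I : ℂ)⁻¹ • ∮ w in C(z, r), ((w - z) ^ 2)⁻¹ • f w := fun f hf =>
    (two_pi_I_inv_smul_circleIntegral_sub_sq_inv_smul_of_differentiable hU hre hf
      (Metric.mem_ball_self hr0)).symm
  have hcont : Continuous fun θ : ℝ => Real.Gamma (circleMap z r θ).re := by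
    refine continuous_iff_continuousAt.2 fun θ => ?_
    have : 0 < (circleMap z r θ).re := hre _ (circleMap_mem_closedBall z hr0.le θ)
    exact ContinuousAt.comp (f := fun θ : ℝ => (circleMap z r θ).re)
      (Real.differentiableAt_Gamma fun m => by
        have : (0 : ℝ) ≤ m := by positivity
        linarith).continuousAt (by fun_prop)
  rw [cauchy Gamma fun w hw => (Complex.differentiableAt_Gamma w fun m h => by
    have : (0 : ℝ) < w.re := hw
    rw [h] at this
    simp at this
    have : (0 : ℝ) ≤ m := by positivity
    linarith).differentiableWithinAt]
  refine Filter.Tendsto.congr' (f₁ := fun n : ℕ => (2 * Real.pi * I : ℂ)⁻¹ •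
    ∮ w in C(z, r), ((w - z) ^ 2)⁻¹ • GammaSeq w n) ?_ ?_
  · filter_upwards [Filter.eventually_ne_atTop 0] with n hn
    exact (cauchy _ fun w hw => (differentiableAt_GammaSeq hw hn).differentiableWithinAt).symm
  refine Filter.Tendsto.const_smul ?_ _
  unfold circleIntegral
  refine intervalIntegral.tendsto_integral_filter_of_dominated_convergence
    (fun θ => r * ((r ^ 2)⁻¹ * Real.Gamma (circleMap z r θ).re)) ?_ ?_ ?_ ?_
  · filter_upwards [Filter.eventually_ne_atTop 0] with n hn
    have hc : Continuous fun θ : ℝ => GammaSeq (circleMap z r θ) n :=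
      continuous_iff_continuousAt.2 fun θ =>
        ContinuousAt.comp (f := fun θ : ℝ => circleMap z r θ) (g := fun w => GammaSeq w n)
          (differentiableAt_GammaSeq (hre _ (circleMap_mem_closedBall z hr0.le θ)) hn).continuousAt
          (by fun_prop)
    have hc2 : Continuous fun θ : ℝ => ((circleMap z r θ - z) ^ 2)⁻¹ :=
      Continuous.inv₀ (by fun_prop) fun θ => by simp [hr0.ne']
    refine Continuous.aestronglyMeasurable ?_
    simp only [deriv_circleMap]
    exact ((continuous_circleMap 0 r).mul continuous_const).smul (hc2.smul hc)
  · filter_upwards [Filter.eventually_ne_atTop 0] with n hn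
    refine .of_forall fun θ _ => ?_
    rw [norm_smul, norm_smul]
    have h1 := norm_GammaSeq_le (hre _ (circleMap_mem_closedBall z hr0.le θ)) hn
    simp only [deriv_circleMap, norm_mul, norm_circleMap_zero, Complex.norm_I, norm_inv, norm_pow,
      circleMap_sub_center, abs_of_pos hr0, mul_one]
    gcongr
  · exact (by fun_prop : Continuous fun θ =>
      r * ((r ^ 2)⁻¹ * Real.Gamma (circleMap z r θ).re)).intervalIntegrable _ _
  · refine .of_forall fun θ _ => ?_
    exact ((GammaSeq_tendsto_Gamma _).const_smul _).const_smul _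

lemma tendsto_log_sub_sum_digamma {z : ℂ} (hz : 0 < z.re) :
    Filter.Tendsto (fun n : ℕ => (Real.log n : ℂ) - ∑ k ∈ Finset.range (n + 1), 1 / (z + k))
      Filter.atTop (nhds (digamma z)) := by
  have := (tendsto_deriv_GammaSeq hz).div (GammaSeq_tendsto_Gamma z) (Gamma_ne_zero_of_re_pos hz)
  rw [digamma_def, logDeriv_apply]
  refine this.congr' ?_
  filter_upwards [Filter.eventually_ne_atTop 0] with n hn
  rw [← logDeriv_GammaSeq hz hn, logDeriv_apply]
  rfl

lemma norm_log_add_one_sub_le {z : ℂ} (hz : 0 < z.re) :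
    ‖log (z + 1) - log z - (1 / z + 1 / (z + 1)) / 2 + (-1 / (z + 1) ^ 2 + 1 / z ^ 2) / 12‖ ≤
      1 / (30 * ‖z‖ ^ 5) := by
  have hpos : ∀ u ∈ Set.Icc (0 : ℝ) 1, 0 < (z + u).re := fun u hu => by
    have := hu.1
    simp only [add_re, ofReal_re]; linarith
  have hne : ∀ u ∈ Set.Icc (0 : ℝ) 1, z + u ≠ 0 := fun u hu h => by
    have := hpos u hu
    simp [h] at this
  have hid : ∀ u : ℝ, HasDerivAt (fun u : ℝ => z + (u : ℂ)) 1 u := fun u =>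
    (Complex.ofRealCLM.hasDerivAt (x := u)).const_add z
  have hz0 : 0 < ‖z‖ := norm_pos_iff.2 fun h => by simp [h] at hz
  have hpow : ∀ (m : ℕ) (c d : ℂ), d = -(c * m) → ∀ u ∈ Set.Icc (0 : ℝ) 1,
      HasDerivAt (fun u : ℝ => c * ((z + (u : ℂ)) ^ m)⁻¹)
        (d * ((z + (u : ℂ)) ^ (m + 1))⁻¹) u := fun m c d hd u hu => by
    have h := hne u hu
    refine ((((hid u).pow m).inv (pow_ne_zero _ h)).const_mul c).congr_deriv ?_
    rw [hd, Pi.pow_apply]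
    rcases m with - | m
    · simp
    · simp only [add_tsub_cancel_right]
      field_simp
      ring
  have h₁ := hpow 1 1 (-1) (by norm_num)
  have h₂ := hpow 2 (-1) 2 (by norm_num)
  have h₃ := hpow 3 2 (-6) (by norm_num)
  have h₄ := hpow 4 (-6) 24 (by norm_num)
  norm_num only at h₁ h₂ h₃ h₄
  have := norm_sub_eulerMaclaurin_le (F := fun u => log (z + u)) (M := 24 / ‖z‖ ^ 5) ?_ h₁ h₂ h₃ h₄ ?_ ?_
  · refine le_of_eq_of_le (congrArg _ ?_) (this.trans_eq ?_)
    · simp only [ofReal_one, ofReal_zero, add_zero, one_div, pow_one, one_mul]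
      ring
    · field_simp; norm_num
  · intro u hu
    refine ((hid u).clog_real (Or.inl (hpos u hu))).congr_deriv ?_
    simp
  · exact continuousOn_const.mul
      (ContinuousOn.inv₀ (by fun_prop) fun u hu => pow_ne_zero _ (hne u hu))
  · intro u hu
    have hle : ‖z‖ ≤ ‖z + u‖ := by
      rw [Complex.norm_def, Complex.norm_def]
      refine Real.sqrt_le_sqrt ?_
      simp only [normSq_apply, add_re, ofReal_re, add_im, ofReal_im, add_zero]
      have := hu.1
      nlinarith
    rw [norm_mul, norm_inv, norm_pow, div_eq_mul_inv]
    norm_num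
    gcongr

lemma tendsto_log_add_natCast_sub {z : ℂ} (hz : 0 < z.re) :
    Filter.Tendsto (fun n : ℕ => log (z + n) - Real.log n) Filter.atTop (nhds 0) := by
  have h : Filter.Tendsto (fun n : ℕ => log (1 + z / n)) Filter.atTop (nhds (log (1 + 0))) := by
    refine ((continuousAt_clog (by simp)).tendsto).comp ?_
    exact (tendsto_const_div_atTop_nhds_zero_nat z).const_add 1
  rw [add_zero, log_one] at h
  refine h.congr' ?_
  filter_upwards [Filter.eventually_gt_atTop 0] with n hn
  have hn' : (0 : ℝ) < n := by exact_mod_cast hn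
  have hnc : (n : ℂ) ≠ 0 := by exact_mod_cast hn.ne'
  have : z + n = ((n : ℝ) : ℂ) * (1 + z / n) := by push_cast; field_simp; ring
  rw [this, log_ofReal_mul hn' ?_]
  · ring
  · intro h0
    rw [h0, mul_zero] at this
    exact add_natCast_ne_zero hz n this

lemma tendsto_inv_add_natCast (z : ℂ) :
    Filter.Tendsto (fun n : ℕ => (z + n)⁻¹) Filter.atTop (nhds 0) := by
  refine Filter.tendsto_inv₀_cobounded.comp ?_
  refine tendsto_norm_atTop_iff_cobounded.1 ?_
  refine Filter.tendsto_atTop_mono (f := fun n : ℕ => (n : ℝ) - ‖z‖) (fun n => ?_)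
    (Filter.tendsto_atTop_add_const_right _ _ tendsto_natCast_atTop_atTop)
  have := norm_sub_le (z + n) z
  rw [add_sub_cancel_left, Complex.norm_natCast] at this
  linarith

lemma norm_digamma_sub_le {z : ℂ} (hz : 0 < z.re) (hy : 3 ≤ z.im) :
    ‖digamma z - (log z - 1 / (2 * z) - 1 / (12 * z ^ 2))‖ ≤ 1 / 1000 := by
  set e : ℕ → ℂ := fun k => log (z + k + 1) - log (z + k) - (1 / (z + k) + 1 / (z + k + 1)) / 2 +
    (-1 / (z + k + 1) ^ 2 + 1 / (z + k) ^ 2) / 12 with he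
  have hsum : ∀ n : ℕ, ∑ k ∈ Finset.range n, e k =
      log (z + n) - log z - ∑ k ∈ Finset.range (n + 1), 1 / (z + k) + (1 / z + 1 / (z + n)) / 2 +
      (-1 / (z + n) ^ 2 + 1 / z ^ 2) / 12 := fun n => by
    induction n with
    | zero => simp; ring
    | succ n ih =>
      rw [Finset.sum_range_succ, ih, Finset.sum_range_succ _ (n + 1), he]
      push_cast
      simp only [add_assoc]
      ring
  have hbound : ∀ k : ℕ, ‖e k‖ ≤ 1 / 405 * (1 / (k + 5 / 2) - 1 / ((k + 1 : ℕ) + 5 / 2)) := fun k => by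
    have hk0 : (0 : ℝ) ≤ k := by positivity
    refine (norm_log_add_one_sub_le (z := z + k) (by simp; linarith)).trans ?_
    have h3 : 3 ≤ ‖z + k‖ := hy.trans (by simpa using Complex.im_le_norm (z + k))
    have h2 : 9 + (k : ℝ) ^ 2 ≤ ‖z + k‖ ^ 2 := by
      rw [Complex.sq_norm, normSq_apply]
      simp only [add_re, natCast_re, add_im, natCast_im, add_zero]
      nlinarith
    have h5 : 27 * (9 + (k : ℝ) ^ 2) ≤ ‖z + k‖ ^ 5 := by
      have h33 : (27 : ℝ) ≤ ‖z + k‖ ^ 3 := by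
        calc (27 : ℝ) = 3 ^ 3 := by norm_num
          _ ≤ _ := by gcongr
      calc 27 * (9 + (k : ℝ) ^ 2) ≤ ‖z + k‖ ^ 3 * ‖z + k‖ ^ 2 := by gcongr
        _ = _ := by ring
    calc 1 / (30 * ‖z + k‖ ^ 5) ≤ 1 / (30 * (27 * (9 + (k : ℝ) ^ 2))) := by gcongr
      _ ≤ _ := by
        push_cast
        rw [div_sub_div _ _ (by positivity) (by positivity), div_mul_div_comm,
          div_le_div_iff₀ (by positivity) (by positivity)]
        nlinarith [sq_nonneg ((k : ℝ) - 3)]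
  have hnorm : ∀ n : ℕ, ‖∑ k ∈ Finset.range n, e k‖ ≤ 1 / 1000 := fun n => by
    refine (norm_sum_le_of_le _ fun k _ => hbound k).trans ?_
    rw [← Finset.mul_sum, Finset.sum_range_sub' (fun k : ℕ => 1 / ((k : ℝ) + 5 / 2))]
    have : 0 ≤ 1 / ((n : ℝ) + 5 / 2) := by positivity
    norm_num only [Nat.cast_zero]
    linarith
  have hlim : Filter.Tendsto (fun n : ℕ => ∑ k ∈ Finset.range n, e k) Filter.atTop
      (nhds (digamma z - (log z - 1 / (2 * z) - 1 / (12 * z ^ 2)))) := by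
    have h1 := tendsto_inv_add_natCast z
    have h := ((((tendsto_log_sub_sum_digamma hz).add (tendsto_log_add_natCast_sub hz)).sub_const
      (log z - 1 / (2 * z) - 1 / (12 * z ^ 2))).add (h1.div_const 2)).sub ((h1.pow 2).div_const 12)
    simp only [add_zero, zero_div, ne_eq, OfNat.ofNat_ne_zero, not_false_eq_true, zero_pow,
      sub_zero] at h
    refine h.congr fun n => ?_
    rw [hsum]
    simp only [mul_inv, inv_pow, div_eq_mul_inv]
    ring
  exact le_of_tendsto hlim.norm (.of_forall hnorm)

lemma re_digamma_mono {x y₁ y₂ : ℝ} (hx : 0 < x) (h : y₁ ^ 2 ≤ y₂ ^ 2) :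
    (digamma (x + y₁ * I)).re ≤ (digamma (x + y₂ * I)).re := by
  have hz : ∀ y : ℝ, 0 < ((x : ℂ) + y * I).re := fun y => by simpa using hx
  have hlim := fun y : ℝ => (Complex.continuous_re.tendsto _).comp (tendsto_log_sub_sum_digamma (hz y))
  refine le_of_tendsto_of_tendsto' (hlim y₁) (hlim y₂) fun n => ?_
  simp only [Function.comp_apply, sub_re, re_sum]
  refine sub_le_sub_left (Finset.sum_le_sum fun k _ => ?_) _
  have hk0 : (0 : ℝ) ≤ k := by positivity
  simp only [one_div, inv_re, normSq_apply, add_re, ofReal_re, mul_re, I_re, mul_zero, ofReal_im,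
    I_im, mul_one, sub_self, add_zero, natCast_re, add_im, mul_im, zero_add, natCast_im]
  have : 0 < x + k := by positivity
  refine div_le_div_of_nonneg_left this.le (by nlinarith [sq_nonneg y₁]) ?_
  nlinarith

lemma re_digamma_approx_eq (y : ℝ) (hy : 0 < y) :
    (log ((1 / 4 : ℝ) + y * I) - 1 / (2 * ((1 / 4 : ℝ) + y * I)) -
      1 / (12 * ((1 / 4 : ℝ) + y * I) ^ 2)).re =
    Real.log (1 / 16 + y ^ 2) / 2 - 1 / (8 * (1 / 16 + y ^ 2)) +
      (y ^ 2 - 1 / 16) / (12 * (1 / 16 + y ^ 2) ^ 2) := by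
  have hq : normSq ((1 / 4 : ℝ) + y * I) = 1 / 16 + y ^ 2 := by
    simp [normSq_apply]; ring
  have hq0 : (0 : ℝ) < 1 / 16 + y ^ 2 := by positivity
  have h1 : 1 / (2 * (((1 / 4 : ℝ) : ℂ) + y * I)) = ((1 / 2 : ℝ) : ℂ) * (((1 / 4 : ℝ) : ℂ) + y * I)⁻¹ := by
    push_cast
    rw [one_div, mul_inv]
    ring
  have h2 : 1 / (12 * (((1 / 4 : ℝ) : ℂ) + y * I) ^ 2) =
      ((1 / 12 : ℝ) : ℂ) * ((((1 / 4 : ℝ) : ℂ) + y * I) ^ 2)⁻¹ := by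
    push_cast
    rw [one_div, mul_inv]
    ring
  rw [h1, h2, sub_re, sub_re, log_re, re_ofReal_mul, re_ofReal_mul, inv_re, inv_re, map_pow, hq,
    Complex.norm_def, hq, Real.log_sqrt hq0.le]
  simp only [add_re, ofReal_re, mul_re, I_re, mul_zero, ofReal_im, I_im, mul_one, sub_self, add_zero,
    pow_two, add_im, mul_im, zero_add]
  field_simp
  ring

lemma re_digamma_lt_log_pi {y : ℝ} (hy : y ^ 2 ≤ 3.135 ^ 2) :
    (digamma ((1 / 4 : ℝ) + y * I)).re < Real.log Real.pi := by
  refine (re_digamma_mono (by norm_num) hy).trans_lt ?_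
  have h := (Complex.re_le_norm _).trans (norm_digamma_sub_le
    (z := ((1 / 4 : ℝ) : ℂ) + (3.135 : ℝ) * I) (by norm_num) (by norm_num))
  rw [sub_re, re_digamma_approx_eq _ (by norm_num)] at h
  have hpi := Real.pi_gt_d4
  have hlog : Real.log (1 / 16 + 3.135 ^ 2) - 2 * Real.log Real.pi ≤ 0.003 := by
    have hpi2 : (9.869 : ℝ) < Real.pi ^ 2 := by nlinarith
    rw [show 2 * Real.log Real.pi = Real.log (Real.pi ^ 2) by rw [Real.log_pow]; norm_num,
      ← Real.log_div (by norm_num) (by positivity)]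
    refine (Real.log_le_sub_one_of_pos (by positivity)).trans ?_
    rw [sub_le_iff_le_add, div_le_iff₀ (by positivity)]
    nlinarith
  norm_num at h hlog ⊢
  linarith

lemma log_pi_lt_re_digamma {y : ℝ} (hy : 3.155 ^ 2 ≤ y ^ 2) :
    Real.log Real.pi < (digamma ((1 / 4 : ℝ) + y * I)).re := by
  refine lt_of_lt_of_le ?_ (re_digamma_mono (by norm_num) hy)
  have h := (Complex.abs_re_le_norm _).trans (norm_digamma_sub_le
    (z := ((1 / 4 : ℝ) : ℂ) + (3.155 : ℝ) * I) (by norm_num) (by norm_num))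
  rw [sub_re, re_digamma_approx_eq _ (by norm_num)] at h
  replace h := (abs_le.1 h).1
  have hpi := Real.pi_lt_d4
  have hpi0 := Real.pi_pos
  have hlog : 2 * Real.log Real.pi - Real.log (1 / 16 + 3.155 ^ 2) ≤ -0.0146 := by
    have hpi2 : Real.pi ^ 2 < (9.87 : ℝ) := by nlinarith
    rw [show 2 * Real.log Real.pi = Real.log (Real.pi ^ 2) by rw [Real.log_pow]; norm_num,
      ← Real.log_div (by positivity) (by norm_num)]
    refine (Real.log_le_sub_one_of_pos (by positivity)).trans ?_
    rw [sub_le_iff_le_add, div_le_iff₀ (by positivity)]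
    nlinarith
  norm_num at h hlog ⊢
  linarith
section

open scoped ComplexConjugate

lemma Gammaℝ_conj (s : ℂ) : Gammaℝ (conj s) = conj (Gammaℝ s) := by
  have hpi : (Real.pi : ℂ).arg ≠ Real.pi := by
    rw [arg_ofReal_of_nonneg Real.pi_pos.le]; exact Real.pi_pos.ne
  rw [Gammaℝ_def, Gammaℝ_def, map_mul, ← Gamma_conj, show -conj s / 2 = conj (-s / 2) by simp [conj_ofNat],
    cpow_conj _ _ hpi]
  simp [conj_ofNat]

lemma hasDerivAt_Gammaℝ {s : ℂ} (hs : 0 < s.re) :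
    HasDerivAt Gammaℝ (Gammaℝ s * (-(Real.log Real.pi : ℂ) / 2 + digamma (s / 2) / 2)) s := by
  have hpi : (Real.pi : ℂ) ≠ 0 := by exact_mod_cast Real.pi_ne_zero
  have hs2 : 0 < (s / 2).re := by simpa using hs
  have hG : HasDerivAt Gamma (deriv Gamma (s / 2)) (s / 2) :=
    (Complex.differentiableAt_Gamma _ fun m h => by
      rw [h] at hs2
      simp at hs2
      have : (0 : ℝ) ≤ m := by positivity
      linarith).hasDerivAt
  have h1 : HasDerivAt (fun w : ℂ => (Real.pi : ℂ) ^ (-w / 2) * Gamma (w / 2)) _ s :=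
    ((((hasDerivAt_id' s).neg).div_const 2).const_cpow (c := (Real.pi : ℂ)) (Or.inl hpi)).mul
      (hG.comp s ((hasDerivAt_id' s).div_const 2))
  refine h1.congr_deriv ?_
  have hne := Gamma_ne_zero_of_re_pos hs2
  rw [Gammaℝ_def, digamma_def, logDeriv_apply, ofReal_log Real.pi_pos.le]
  simp only [Pi.neg_apply]
  field_simp

lemma deriv_riemannZeta_conj (s : ℂ) : deriv riemannZeta (conj s) = conj (deriv riemannZeta s) := by
  have h := congrFun (deriv_conj_conj (f := riemannZeta)) (conj s)
  have e : (conj : ℂ → ℂ) ∘ riemannZeta ∘ (conj : ℂ → ℂ) = riemannZeta := by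
    ext w
    simp [riemannZeta_conj]
  rw [e] at h
  simpa using h

/-- A critical point of `ζ` on the critical line that is not a zero forces
`Re ψ(1/4 + it/2) = log π`. -/
lemma re_digamma_eq_log_pi {t : ℝ} (h : riemannZeta (1 / 2 + t * I) ≠ 0)
    (h' : deriv riemannZeta (1 / 2 + t * I) = 0) :
    (digamma ((1 / 4 : ℝ) + (t / 2 : ℝ) * I)).re = Real.log Real.pi := by
  set s : ℂ := 1 / 2 + t * I with hs
  have hre : s.re = 1 / 2 := by simp [hs]
  have hs1 : s ≠ 1 := fun h => by rw [h] at hre; norm_num at hre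
  have hs0 : s ≠ 0 := fun h => by rw [h] at hre; norm_num at hre
  have hconj : conj s = 1 - s := by
    simp only [hs, map_add, map_mul, conj_I, conj_ofReal, map_div₀, map_one, conj_ofNat]
    ring
  set f : ℂ → ℂ := fun w => Gammaℝ w * riemannZeta w with hf
  have hfΛ : ∀ w : ℂ, 0 < w.re → f w = completedRiemannZeta w := fun w hw => by
    have hw0 : w ≠ 0 := fun h => by simp [h] at hw
    have := Gammaℝ_ne_zero_of_re_pos hw
    simp only [hf, riemannZeta_def_of_ne_zero hw0]
    field_simp
  have hfc : (conj : ℂ → ℂ) ∘ f ∘ (conj : ℂ → ℂ) = f := by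
    ext w
    simp [hf, riemannZeta_conj, Gammaℝ_conj]
  set c : ℂ := -(Real.log Real.pi : ℂ) / 2 + digamma (s / 2) / 2 with hc
  have hd : HasDerivAt f (f s * c) s := by
    have h1 := (hasDerivAt_Gammaℝ (s := s) (by rw [hre]; norm_num)).mul
      (differentiableAt_riemannZeta hs1).hasDerivAt
    refine h1.congr_deriv ?_
    rw [h']
    simp only [hf]
    ring
  have hd2 : HasDerivAt f (conj (f s * c)) (1 - s) := by
    have := hd.conj_conj
    rwa [hfc, hconj] at this
  have hd3 : HasDerivAt f (conj (f s * c) * -1) s := by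
    have h3 : HasDerivAt (fun w => f (1 - w)) (conj (f s * c) * -1) s :=
      hd2.comp s ((hasDerivAt_id' s).const_sub 1)
    refine h3.congr_of_eventuallyEq ?_
    have h4 : ∀ᶠ w in nhds s, 0 < w.re := (isOpen_lt continuous_const continuous_re).mem_nhds
      (by simp [hre])
    have h5 : ∀ᶠ w in nhds s, w.re < 1 := (isOpen_lt continuous_re continuous_const).mem_nhds
      (by simp [hre]; norm_num)
    filter_upwards [h4, h5] with w hw hw'
    rw [hfΛ _ hw, hfΛ _ (by simpa using hw'), completedRiemannZeta_one_sub]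
  have hreal : conj (f s) = f s := by
    have h6 := congrFun hfc s
    simp only [Function.comp_apply, hconj] at h6
    rw [hfΛ (1 - s) (by simp [hre]; norm_num), completedRiemannZeta_one_sub,
      ← hfΛ s (by simp [hre])] at h6
    exact h6
  have hfs : f s ≠ 0 := mul_ne_zero (Gammaℝ_ne_zero_of_re_pos (by simp [hre])) h
  have heq : f s * c = f s * (conj c * -1) := by
    rw [hd.unique hd3, map_mul, hreal, mul_assoc]
  have hcre := congrArg Complex.re (mul_left_cancel₀ hfs heq)
  have hs2 : s / 2 = (1 / 4 : ℝ) + (t / 2 : ℝ) * I := by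
    rw [hs]; push_cast; ring
  simp only [mul_neg, mul_one, neg_re, conj_re] at hcre
  have hcre' : c.re = 0 := by linarith
  rw [hc, hs2, ← ofReal_neg, add_re, div_ofNat_re, div_ofNat_re, ofReal_re] at hcre'
  linarith

lemma abs_mem_Icc_of_deriv_riemannZeta_eq_zero {t : ℝ} (h : riemannZeta (1 / 2 + t * I) ≠ 0)
    (h' : deriv riemannZeta (1 / 2 + t * I) = 0) : |t| ∈ Set.Icc (6.27 : ℝ) 6.31 := by
  have hpsi := re_digamma_eq_log_pi h h'
  have h1 : (3.135 : ℝ) ^ 2 < (t / 2) ^ 2 := by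
    by_contra! hle
    exact (re_digamma_lt_log_pi hle).ne hpsi
  have h2 : (t / 2) ^ 2 < (3.155 : ℝ) ^ 2 := by
    by_contra! hle
    exact (log_pi_lt_re_digamma hle).ne hpsi.symm
  rw [← sq_abs (t / 2), abs_div] at h1 h2
  norm_num at h1 h2
  have := abs_nonneg t
  constructor <;> norm_num <;> nlinarith

end

/-- The error of the fourth-order Euler–Maclaurin formula for `x ↦ x ^ (-s)` on `[n, n + 1]`. -/
noncomputable def zetaError (s : ℂ) (n : ℕ) : ℂ :=
  (((n + 1 : ℕ) : ℂ) ^ (1 - s) - (n : ℂ) ^ (1 - s)) / (1 - s)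
    - ((n : ℂ) ^ (-s) + ((n + 1 : ℕ) : ℂ) ^ (-s)) / 2
    + (-s * ((n + 1 : ℕ) : ℂ) ^ (-s - 1) - -s * (n : ℂ) ^ (-s - 1)) / 12

lemma norm_zetaError_le {s : ℂ} (hs : 0 ≤ s.re) (hs1 : s ≠ 1) {n : ℕ} (hn : 1 ≤ n) :
    ‖zetaError s n‖ ≤ ‖s‖ * ‖s + 1‖ * ‖s + 2‖ * ‖s + 3‖ / 720 * (1 / (n : ℝ) ^ 4) := by
  have hn1 : (1 : ℝ) ≤ n := by exact_mod_cast hn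
  have hpos : ∀ u ∈ Set.Icc (0 : ℝ) 1, 0 < (n : ℝ) + u := fun u hu => by linarith [hu.1]
  have hs1' : 1 - s ≠ 0 := sub_ne_zero.2 hs1.symm
  have hder : ∀ r c d e : ℂ, d = c * r → e = r - 1 → ∀ u ∈ Set.Icc (0 : ℝ) 1,
      HasDerivAt (fun u : ℝ => c * ((n : ℂ) + (u : ℂ)) ^ r) (d * ((n : ℂ) + (u : ℂ)) ^ e) u := by
    intro r c d e hd he u hu
    have hmem : (n : ℂ) + (u : ℂ) ∈ slitPlane := Or.inl (by simpa using hpos u hu)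
    have h1 : HasDerivAt (fun w : ℂ => c * ((n : ℂ) + w) ^ r) (d * ((n : ℂ) + (u : ℂ)) ^ e) (u : ℂ) := by
      refine ((((hasDerivAt_id' (u : ℂ)).const_add (n : ℂ)).cpow_const hmem).const_mul c).congr_deriv ?_
      rw [hd, he]; ring
    exact h1.comp_ofReal
  have h₀ := hder (1 - s) (1 / (1 - s)) 1 (-s) (by field_simp) (by ring)
  have h₁ := hder (-s) 1 (-s) (-s - 1) (by ring) rfl
  have h₂ := hder (-s - 1) (-s) (s * (s + 1)) (-s - 2) (by ring) (by ring)
  have h₃ := hder (-s - 2) (s * (s + 1)) (-(s * (s + 1) * (s + 2))) (-s - 3) (by ring) (by ring)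
  have h₄ := hder (-s - 3) (-(s * (s + 1) * (s + 2))) (s * (s + 1) * (s + 2) * (s + 3)) (-s - 4)
    (by ring) (by ring)
  have := norm_sub_eulerMaclaurin_le
    (M := ‖s‖ * ‖s + 1‖ * ‖s + 2‖ * ‖s + 3‖ * (1 / (n : ℝ) ^ 4)) h₀ h₁ h₂ h₃ h₄ ?_ ?_
  · refine le_of_eq_of_le (congrArg _ ?_) (this.trans_eq (by ring))
    rw [zetaError]
    push_cast
    simp only [add_zero]
    ring
  · have hc : Continuous fun u : ℝ => (n : ℂ) + (u : ℂ) := by fun_prop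
    refine continuousOn_const.mul (hc.continuousOn.cpow_const fun u hu => Or.inl ?_)
    simpa using hpos u hu
  · intro u hu
    have e1 : (n : ℂ) + (u : ℂ) = ((n + u : ℝ) : ℂ) := by push_cast; rfl
    rw [norm_mul, norm_mul, norm_mul, norm_mul, e1, norm_cpow_eq_rpow_re_of_pos (hpos u hu)]
    gcongr
    have h1 : (1 : ℝ) ≤ n + u := by linarith [hu.1]
    calc ((n : ℝ) + u) ^ (-s - 4).re ≤ ((n : ℝ) + u) ^ (-((4 : ℕ) : ℝ)) :=
          Real.rpow_le_rpow_of_exponent_le h1 (by simp; linarith)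
      _ = 1 / ((n : ℝ) + u) ^ 4 := by
          rw [Real.rpow_neg (by linarith), Real.rpow_natCast, one_div]
      _ ≤ 1 / (n : ℝ) ^ 4 := by
          gcongr
          linarith [hu.1]

lemma one_div_pow_four_le (n : ℕ) : 1 / ((n + 4 : ℕ) : ℝ) ^ 4 ≤
    1 / (3 * ((n : ℝ) + 7 / 2) ^ 3) - 1 / (3 * (((n + 1 : ℕ) : ℝ) + 7 / 2) ^ 3) := by
  obtain ⟨m, hm⟩ : ∃ m : ℝ, m = n + 4 := ⟨_, rfl⟩
  have hm4 : 4 ≤ m := by rw [hm]; have : (0 : ℝ) ≤ n := by positivity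
                         linarith
  push_cast
  rw [show (n : ℝ) + 4 = m from hm.symm, show (n : ℝ) + 7 / 2 = m - 1 / 2 by rw [hm]; ring,
    show (n : ℝ) + 1 + 7 / 2 = m + 1 / 2 by rw [hm]; ring]
  have h1 : 0 < m - 1 / 2 := by linarith
  have h2 : 0 < m + 1 / 2 := by linarith
  rw [div_sub_div _ _ (by positivity) (by positivity), div_le_div_iff₀ (by positivity) (by positivity)]
  nlinarith [pow_pos (show 0 < m by linarith) 2, pow_pos (show 0 < m by linarith) 4,
    pow_pos (show 0 < m by linarith) 6, pow_pos (show 0 < m by linarith) 3]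

lemma hasSum_telescope : HasSum (fun n : ℕ => 1 / (3 * ((n : ℝ) + 7 / 2) ^ 3) -
    1 / (3 * (((n + 1 : ℕ) : ℝ) + 7 / 2) ^ 3)) (8 / 1029) := by
  rw [hasSum_iff_tendsto_nat_of_nonneg fun n => (by positivity : (0 : ℝ) ≤ 1 / ((n + 4 : ℕ) : ℝ) ^ 4).trans
    (one_div_pow_four_le n)]
  simp only [Finset.sum_range_sub' (fun n : ℕ => 1 / (3 * ((n : ℝ) + 7 / 2) ^ 3))]
  have h : Filter.Tendsto (fun n : ℕ => 1 / (3 * ((n : ℝ) + 7 / 2) ^ 3)) Filter.atTop (nhds 0) := by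
    simp only [one_div]
    refine Filter.Tendsto.inv_tendsto_atTop (Filter.Tendsto.const_mul_atTop (by norm_num) ?_)
    exact (Filter.tendsto_pow_atTop (by norm_num)).comp
      (Filter.tendsto_atTop_add_const_right _ _ tendsto_natCast_atTop_atTop)
  have := h.const_sub (1 / (3 * (((0 : ℕ) : ℝ) + 7 / 2) ^ 3))
  norm_num at this ⊢
  exact this

lemma norm_zetaError_add_four_le {s : ℂ} (hs : 0 ≤ s.re) (hs1 : s ≠ 1) (n : ℕ) :
    ‖zetaError s (n + 4)‖ ≤ ‖s‖ * ‖s + 1‖ * ‖s + 2‖ * ‖s + 3‖ / 720 *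
      (1 / (3 * ((n : ℝ) + 7 / 2) ^ 3) - 1 / (3 * (((n + 1 : ℕ) : ℝ) + 7 / 2) ^ 3)) :=
  (norm_zetaError_le hs hs1 (by omega)).trans
    (mul_le_mul_of_nonneg_left (one_div_pow_four_le n) (by positivity))

lemma tendsto_natCast_cpow_zero {r : ℂ} (hr : r.re < 0) :
    Filter.Tendsto (fun n : ℕ => ((n + 4 : ℕ) : ℂ) ^ r) Filter.atTop (nhds 0) := by
  rw [tendsto_zero_iff_norm_tendsto_zero]
  have h := (tendsto_rpow_neg_atTop (y := -r.re) (by linarith)).comp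
    ((tendsto_natCast_atTop_atTop (R := ℝ)).comp (Filter.tendsto_add_atTop_nat 4))
  refine h.congr fun n => ?_
  rw [norm_natCast_cpow_of_pos (by omega)]
  simp

/-- The Euler–Maclaurin main term for `ζ` with four initial terms. -/
noncomputable def zetaMain (s : ℂ) : ℂ :=
  1 + (2 : ℂ) ^ (-s) + (3 : ℂ) ^ (-s) + ((2 : ℂ) ^ (-s)) ^ 2 * (1 / 2 + 4 * (s - 1)⁻¹ + s / 48)

lemma riemannZeta_eq_of_one_lt_re {s : ℂ} (hs : 1 < s.re) :
    riemannZeta s = zetaMain s - ∑' n : ℕ, zetaError s (n + 4) := by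
  have hs1 : s ≠ 1 := fun h => by simp [h] at hs
  have hs1' : 1 - s ≠ 0 := sub_ne_zero.2 hs1.symm
  have hsum : Summable fun n : ℕ => zetaError s (n + 4) :=
    .of_norm_bounded (hasSum_telescope.summable.mul_left _)
      fun n => norm_zetaError_add_four_le (by linarith) hs1 n
  have hpart : ∀ M : ℕ, ∑ n ∈ Finset.range M, zetaError s (n + 4) =
      (((M + 4 : ℕ) : ℂ) ^ (1 - s) - ((4 : ℕ) : ℂ) ^ (1 - s)) / (1 - s)
      - ∑ n ∈ Finset.range M, 1 / ((n + 4 : ℕ) : ℂ) ^ s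
      + (((4 : ℕ) : ℂ) ^ (-s) - ((M + 4 : ℕ) : ℂ) ^ (-s)) / 2
      + (-s * ((M + 4 : ℕ) : ℂ) ^ (-s - 1) - -s * ((4 : ℕ) : ℂ) ^ (-s - 1)) / 12 := fun M => by
    induction M with
    | zero => simp
    | succ M ih =>
      rw [Finset.sum_range_succ, ih, Finset.sum_range_succ, zetaError, one_div, ← cpow_neg,
        show M + 1 + 4 = M + 4 + 1 by ring]
      ring
  have hz : HasSum (fun n : ℕ => 1 / (n : ℂ) ^ s) (riemannZeta s) := by
    rw [zeta_eq_tsum_one_div_nat_cpow hs]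
    exact (Complex.summable_one_div_nat_cpow.2 hs).hasSum
  have hz4 := ((hasSum_nat_add_iff' 4).2 hz).tendsto_sum_nat
  have hlim := ((((tendsto_natCast_cpow_zero (r := 1 - s) (by simp; linarith)).sub_const
    (((4 : ℕ) : ℂ) ^ (1 - s))).div_const (1 - s)).sub hz4).add
    (((tendsto_natCast_cpow_zero (r := -s) (by simp; linarith)).const_sub
      (((4 : ℕ) : ℂ) ^ (-s))).div_const 2) |>.add
    ((((tendsto_natCast_cpow_zero (r := -s - 1) (by simp; linarith)).const_mul (-s)).sub_const
      (-s * ((4 : ℕ) : ℂ) ^ (-s - 1))).div_const 12)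
  have huniq := tendsto_nhds_unique (hlim.congr fun M => (hpart M).symm) hsum.hasSum.tendsto_sum_nat
  rw [← huniq, zetaMain]
  have h4 : ∀ r : ℂ, (4 : ℂ) ^ r = ((2 : ℂ) ^ r) ^ 2 := fun r => by
    rw [pow_two, show (4 : ℂ) = ((2 : ℝ) : ℂ) * ((2 : ℝ) : ℂ) by norm_num,
      mul_cpow_ofReal_nonneg (by norm_num) (by norm_num)]
    norm_num
  have e1 : (2 : ℂ) ^ (1 - s) = 2 * (2 : ℂ) ^ (-s) := by
    rw [sub_eq_add_neg, cpow_add _ _ two_ne_zero, cpow_one]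
  have e2 : (2 : ℂ) ^ (-s - 1) = (2 : ℂ) ^ (-s) / 2 := by
    rw [cpow_sub _ _ two_ne_zero, cpow_one]
  have hs0 : s ≠ 0 := fun h => by rw [h] at hs; norm_num at hs
  simp only [h4, e1, e2, Finset.sum_range_succ, Finset.sum_range_zero, Nat.cast_zero, Nat.cast_one,
    one_cpow, Nat.cast_ofNat, one_div, ← cpow_neg, zero_cpow (neg_ne_zero.2 hs0)]
  have : (1 - s)⁻¹ = -(s - 1)⁻¹ := by rw [← neg_sub, inv_neg]
  rw [div_eq_mul_inv _ (1 - s), this]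
  ring

/-- A bounded convex region meeting both the critical strip and the half-plane of convergence. -/
def eulerMaclaurinRegion : Set ℂ := (re ⁻¹' Set.Ioo 0 3) ∩ (im ⁻¹' Set.Ioo 1 8)

lemma isOpen_eulerMaclaurinRegion : IsOpen eulerMaclaurinRegion :=
  (isOpen_Ioo.preimage continuous_re).inter (isOpen_Ioo.preimage continuous_im)

lemma ne_one_of_mem_eulerMaclaurinRegion {s : ℂ} (hs : s ∈ eulerMaclaurinRegion) : s ≠ 1 := by
  rintro rfl
  have := hs.2.1
  norm_num at this

lemma differentiableOn_tsum_zetaError :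
    DifferentiableOn ℂ (fun s => ∑' n : ℕ, zetaError s (n + 4)) eulerMaclaurinRegion := by
  refine differentiableOn_tsum_of_summable_norm
    (hasSum_telescope.summable.mul_left (20 * 20 * 20 * 20 / 720)) (fun n => ?_)
    isOpen_eulerMaclaurinRegion fun n s hs => ?_
  · intro s hs
    have h1 : 1 - s ≠ 0 := sub_ne_zero.2 (ne_one_of_mem_eulerMaclaurinRegion hs).symm
    have hc : ∀ m : ℕ, m ≠ 0 → ∀ f : ℂ → ℂ, DifferentiableAt ℂ f s →
        DifferentiableAt ℂ (fun w => (m : ℂ) ^ f w) s := fun m hm f hf =>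
      hf.const_cpow (Or.inl (by exact_mod_cast hm))
    have c1 := hc (n + 4) (by omega) (fun w => 1 - w) (by fun_prop)
    have c2 := hc (n + 4 + 1) (by omega) (fun w => 1 - w) (by fun_prop)
    have c3 := hc (n + 4) (by omega) (fun w => -w) (by fun_prop)
    have c4 := hc (n + 4 + 1) (by omega) (fun w => -w) (by fun_prop)
    have c5 := hc (n + 4) (by omega) (fun w => -w - 1) (by fun_prop)
    have c6 := hc (n + 4 + 1) (by omega) (fun w => -w - 1) (by fun_prop)
    unfold zetaError
    exact DifferentiableAt.differentiableWithinAt (by fun_prop (disch := assumption))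
  · refine (norm_zetaError_add_four_le hs.1.1.le (ne_one_of_mem_eulerMaclaurinRegion hs) n).trans ?_
    have hb : ‖s‖ ≤ 11 := by
      refine (norm_le_abs_re_add_abs_im s).trans ?_
      have h1 := hs.1
      have h2 := hs.2
      simp only [Set.mem_preimage, Set.mem_Ioo] at h1 h2
      rw [abs_of_pos h1.1, abs_of_pos (by linarith)]
      linarith
    have hb' : ∀ a : ℂ, ‖a‖ ≤ 9 → ‖s + a‖ ≤ 20 := fun a ha => (norm_add_le _ _).trans (by linarith)
    have hnn : 0 ≤ 1 / (3 * ((n : ℝ) + 7 / 2) ^ 3) - 1 / (3 * (((n + 1 : ℕ) : ℝ) + 7 / 2) ^ 3) :=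
      (by positivity : (0 : ℝ) ≤ 1 / ((n + 4 : ℕ) : ℝ) ^ 4).trans (one_div_pow_four_le n)
    gcongr
    · linarith
    · exact hb' 1 (by norm_num)
    · exact hb' 2 (by norm_num)
    · exact hb' 3 (by norm_num)

lemma differentiableAt_zetaMain {s : ℂ} (hs : s ≠ 1) : DifferentiableAt ℂ zetaMain s := by
  have h1 : s - 1 ≠ 0 := sub_ne_zero.2 hs
  have c2 : DifferentiableAt ℂ (fun w : ℂ => (2 : ℂ) ^ (-w)) s :=
    DifferentiableAt.const_cpow (by fun_prop) (Or.inl two_ne_zero)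
  have c3 : DifferentiableAt ℂ (fun w : ℂ => (3 : ℂ) ^ (-w)) s :=
    DifferentiableAt.const_cpow (by fun_prop) (Or.inl three_ne_zero)
  unfold zetaMain
  fun_prop (disch := assumption)

lemma riemannZeta_eqOn : Set.EqOn riemannZeta
    (fun s => zetaMain s - ∑' n : ℕ, zetaError s (n + 4)) eulerMaclaurinRegion := by
  have hconv : Convex ℝ eulerMaclaurinRegion :=
    ((convex_Ioo (0 : ℝ) 3).linear_preimage reLm).inter ((convex_Ioo (1 : ℝ) 8).linear_preimage imLm)
  have hmem : (2 + 2 * I : ℂ) ∈ eulerMaclaurinRegion := by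
    constructor <;> simp <;> norm_num
  refine AnalyticOnNhd.eqOn_of_preconnected_of_eventuallyEq
    (DifferentiableOn.analyticOnNhd (fun s hs => ?_) isOpen_eulerMaclaurinRegion)
    (DifferentiableOn.analyticOnNhd (DifferentiableOn.sub (fun s hs => ?_)
      differentiableOn_tsum_zetaError) isOpen_eulerMaclaurinRegion)
    hconv.isPreconnected hmem ?_
  · exact (differentiableAt_riemannZeta
      (ne_one_of_mem_eulerMaclaurinRegion hs)).differentiableWithinAt
  · exact (differentiableAt_zetaMain
      (ne_one_of_mem_eulerMaclaurinRegion hs)).differentiableWithinAt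
  · filter_upwards [(isOpen_lt continuous_const continuous_re).mem_nhds
      (by simp : (2 + 2 * I : ℂ) ∈ {s : ℂ | 1 < s.re})] with s hs
    exact riemannZeta_eq_of_one_lt_re hs

lemma norm_deriv_riemannZeta_sub_le {t : ℝ} (ht : t ∈ Set.Icc (6.27 : ℝ) 6.31) :
    ‖deriv riemannZeta (1 / 2 + t * I) - deriv zetaMain (1 / 2 + t * I)‖ ≤ 0.065 := by
  set s : ℂ := 1 / 2 + t * I with hs
  have hre : s.re = 1 / 2 := by simp [hs]
  have him : s.im = t := by simp [hs]
  have hball : ∀ w ∈ Metric.closedBall s (0.49 : ℝ),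
      0 < w.re ∧ w.re ≤ 1 ∧ 5.77 ≤ w.im ∧ w.im ≤ 6.81 := fun w hw => by
    rw [Metric.mem_closedBall, dist_eq_norm] at hw
    have h1 := abs_le.1 ((abs_re_le_norm _).trans hw)
    have h2 := abs_le.1 ((abs_im_le_norm _).trans hw)
    rw [sub_re, hre] at h1
    rw [sub_im, him] at h2
    obtain ⟨ht1, ht2⟩ := ht
    norm_num at *
    refine ⟨?_, ?_, ?_, ?_⟩ <;> linarith
  have hsm : s ∈ eulerMaclaurinRegion := by
    obtain ⟨ht1, ht2⟩ := ht
    refine ⟨?_, ?_⟩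
    · simp only [Set.mem_preimage, hre]; norm_num
    · simp only [Set.mem_preimage, him]
      constructor <;> norm_num at * <;> linarith
  have hR := differentiableOn_tsum_zetaError.differentiableAt (isOpen_eulerMaclaurinRegion.mem_nhds hsm)
  have hderiv : deriv riemannZeta s - deriv zetaMain s =
      -deriv (fun s => ∑' n : ℕ, zetaError s (n + 4)) s := by
    rw [(Filter.eventuallyEq_of_mem (isOpen_eulerMaclaurinRegion.mem_nhds hsm)
      riemannZeta_eqOn).deriv_eq,
      deriv_fun_sub (differentiableAt_zetaMain (ne_one_of_mem_eulerMaclaurinRegion hsm)) hR]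
    ring
  rw [hderiv, norm_neg]
  have hcauchy := norm_deriv_le_of_forall_mem_sphere_norm_le (c := s) (R := 0.49) (C := 0.0315)
    (f := fun s => ∑' n : ℕ, zetaError s (n + 4)) (by norm_num) ?_ ?_
  · refine hcauchy.trans (by norm_num)
  · refine (differentiableOn_tsum_zetaError.mono fun w hw => ?_).diffContOnCl
    rw [closure_ball _ (by norm_num)] at hw
    obtain ⟨h1, h2, h3, h4⟩ := hball w hw
    exact ⟨⟨h1, by linarith⟩, by linarith, by linarith⟩
  · intro w hw
    obtain ⟨h1, h2, h3, h4⟩ := hball w (Metric.sphere_subset_closedBall hw)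
    have hw1 : w ≠ 1 := by
      rintro rfl
      norm_num at h3
    have hn : ∀ a b : ℝ, 0 ≤ a → 0 ≤ b → (1 + a) ^ 2 + 6.81 ^ 2 ≤ b ^ 2 → ‖w + a‖ ≤ b :=
      fun a b ha hb hab => by
        refine abs_le_of_sq_le_sq' (a := ‖w + a‖) ?_ hb |>.2
        rw [Complex.sq_norm, normSq_apply]
        simp only [add_re, ofReal_re, add_im, ofReal_im, add_zero]
        have : (w.re + a) * (w.re + a) ≤ (1 + a) ^ 2 := by nlinarith
        have : w.im * w.im ≤ 6.81 ^ 2 := by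
          have : 0 ≤ w.im := by linarith
          nlinarith
        linarith
    have n0 : ‖w‖ ≤ 6.89 := by simpa using hn 0 6.89 le_rfl (by norm_num) (by norm_num)
    have n1 : ‖w + 1‖ ≤ 7.1 := by simpa using hn 1 7.1 (by norm_num) (by norm_num) (by norm_num)
    have n2 : ‖w + 2‖ ≤ 7.45 := by simpa using hn 2 7.45 (by norm_num) (by norm_num) (by norm_num)
    have n3 : ‖w + 3‖ ≤ 7.9 := by simpa using hn 3 7.9 (by norm_num) (by norm_num) (by norm_num)
    refine (tsum_of_norm_bounded (hasSum_telescope.mul_left _)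
      fun n => norm_zetaError_add_four_le h1.le hw1 n).trans ?_
    calc _ ≤ (6.89 * 7.1 * 7.45 * 7.9 / 720 * (8 / 1029) : ℝ) := by gcongr
      _ ≤ _ := by norm_num

lemma ofReal_cpow_neg_half_add {x : ℝ} (hx : 0 < x) (t : ℝ) :
    (x : ℂ) ^ (-(1 / 2 + t * I)) = (Real.exp (-Real.log x / 2) : ℝ) *
      ((Real.cos (t * Real.log x) : ℝ) - (Real.sin (t * Real.log x) : ℝ) * I) := by
  rw [cpow_def_of_ne_zero (ofReal_ne_zero.2 hx.ne'), ← ofReal_log hx.le,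
    show (Real.log x : ℂ) * -(1 / 2 + t * I) =
      ((-Real.log x / 2 : ℝ) : ℂ) + ((-(t * Real.log x) : ℝ) : ℂ) * I by push_cast; ring,
    exp_add, ← ofReal_exp, exp_mul_I, ← ofReal_cos, ← ofReal_sin, Real.cos_neg, Real.sin_neg]
  push_cast
  ring

lemma exp_neg_log_div_two_sq {x : ℝ} (hx : 0 < x) : Real.exp (-Real.log x / 2) ^ 2 = 1 / x := by
  rw [← Real.exp_nat_mul, show ((2 : ℕ) : ℝ) * (-Real.log x / 2) = -Real.log x by push_cast; ring,
    Real.exp_neg, Real.exp_log hx, one_div]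

lemma deriv_zetaMain {s : ℂ} (hs : s ≠ 1) : deriv zetaMain s =
    -(Real.log 2 : ℝ) * (2 : ℂ) ^ (-s) - (Real.log 3 : ℝ) * (3 : ℂ) ^ (-s) +
      ((2 : ℂ) ^ (-s)) ^ 2 * (-2 * (Real.log 2 : ℝ) * (1 / 2 + 4 * (s - 1)⁻¹ + s / 48)
        - 4 * (s - 1)⁻¹ ^ 2 + 1 / 48) := by
  have h1 : s - 1 ≠ 0 := sub_ne_zero.2 hs
  have l2 : log (2 : ℂ) = (Real.log 2 : ℝ) := by rw [ofReal_log (by norm_num)]; norm_num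
  have l3 : log (3 : ℂ) = (Real.log 3 : ℝ) := by rw [ofReal_log (by norm_num)]; norm_num
  have d2 : HasDerivAt (fun w : ℂ => (2 : ℂ) ^ (-w)) ((2 : ℂ) ^ (-s) * log 2 * -1) s :=
    (hasDerivAt_id' s).neg.const_cpow (Or.inl two_ne_zero)
  have d3 : HasDerivAt (fun w : ℂ => (3 : ℂ) ^ (-w)) ((3 : ℂ) ^ (-s) * log 3 * -1) s :=
    (hasDerivAt_id' s).neg.const_cpow (Or.inl three_ne_zero)
  have di : HasDerivAt (fun w : ℂ => (w - 1)⁻¹) (-1 / (s - 1) ^ 2) s :=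
    ((hasDerivAt_id' s).sub_const 1).fun_inv h1
  have := ((d2.const_add 1).add d3).add ((d2.pow 2).mul
    (((di.const_mul 4).const_add (1 / 2)).add ((hasDerivAt_id' s).div_const 48)))
  refine (HasDerivAt.congr_deriv (f := zetaMain) this ?_).deriv
  rw [l2, l3, inv_pow, neg_div, one_div ((s - 1) ^ 2)]
  simp only [Pi.pow_apply, Pi.add_apply]
  push_cast
  ring

lemma im_deriv_zetaMain (t : ℝ) : (deriv zetaMain (1 / 2 + t * I)).im =
    Real.log 2 * Real.exp (-Real.log 2 / 2) * Real.sin (t * Real.log 2) +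
    Real.log 3 * Real.exp (-Real.log 3 / 2) * Real.sin (t * Real.log 3) +
    ((Real.cos (t * Real.log 2) ^ 2 - Real.sin (t * Real.log 2) ^ 2) *
        (2 * Real.log 2 * t * (4 / (1 / 4 + t ^ 2) - 1 / 48) - 4 * t / (1 / 4 + t ^ 2) ^ 2) -
      2 * Real.sin (t * Real.log 2) * Real.cos (t * Real.log 2) *
        (-2 * Real.log 2 * (1 / 2 - 2 / (1 / 4 + t ^ 2) + 1 / 96)
          - 4 * (1 / 4 - t ^ 2) / (1 / 4 + t ^ 2) ^ 2 + 1 / 48)) / 2 := by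
  have hs : (1 / 2 + t * I : ℂ) ≠ 1 := fun h => by
    have := congrArg re h
    norm_num at this
  have hq : (1 / 4 + t ^ 2 : ℝ) ≠ 0 := by positivity
  have hinv : (1 / 2 + t * I - 1 : ℂ)⁻¹ =
      ((-1 / 2 / (1 / 4 + t ^ 2) : ℝ) : ℂ) + ((-t / (1 / 4 + t ^ 2) : ℝ) : ℂ) * I := by
    refine inv_eq_of_mul_eq_one_right ?_
    have hq : (1 / 4 + (t : ℂ) ^ 2) ≠ 0 := by
      have := ofReal_ne_zero.2 (by positivity : (1 / 4 + t ^ 2 : ℝ) ≠ 0)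
      push_cast at this
      exact this
    push_cast
    rw [div_mul_eq_mul_div, ← add_div, mul_div_assoc', div_eq_one_iff_eq hq]
    linear_combination (-(t : ℂ) ^ 2) * I_sq
  have e2 := ofReal_cpow_neg_half_add (x := 2) (by norm_num) t
  have e3 := ofReal_cpow_neg_half_add (x := 3) (by norm_num) t
  have a2 := exp_neg_log_div_two_sq (x := 2) (by norm_num)
  rw [ofReal_ofNat] at e2 e3
  have hD : ∀ l u v : ℝ, -2 * (l : ℂ) * (1 / 2 + 4 * ((u : ℂ) + (v : ℂ) * I) +
      (1 / 2 + t * I) / 48) - 4 * ((u : ℂ) + (v : ℂ) * I) ^ 2 + 1 / 48 =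
      ((-2 * l * (1 / 2 + 4 * u + 1 / 96) - 4 * (u ^ 2 - v ^ 2) + 1 / 48 : ℝ) : ℂ) +
      ((-2 * l * (4 * v + t / 48) - 8 * u * v : ℝ) : ℂ) * I := fun l u v => by
    push_cast
    linear_combination (-4 * (v : ℂ) ^ 2) * I_sq
  have hX : ∀ a c d x y : ℝ, ((((a : ℂ) * (c - d * I)) ^ 2) * (x + y * I)).im =
      a ^ 2 * ((c ^ 2 - d ^ 2) * y - 2 * d * c * x) := fun a c d x y => by
    simp [pow_two]
    ring
  rw [deriv_zetaMain hs, hinv, e2, e3, hD, add_im, hX, a2, sub_im]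
  simp only [mul_im, mul_re, neg_re, neg_im, sub_re, sub_im, ofReal_re, ofReal_im, I_re, I_im]
  field_simp
  ring

lemma neg_le_and_le_of_mem_Icc {t l : ℝ} (ht : t ∈ Set.Icc (6.27 : ℝ) 6.31)
    (h1 : 0.69314 ≤ l) (h2 : l ≤ 0.69315) :
    -0.54 ≤ -2 * l * (1 / 2 - 2 / (1 / 4 + t ^ 2) + 1 / 96)
      - 4 * (1 / 4 - t ^ 2) / (1 / 4 + t ^ 2) ^ 2 + 1 / 48 ∧
    0.65 ≤ 2 * l * t * (4 / (1 / 4 + t ^ 2) - 1 / 48) - 4 * t / (1 / 4 + t ^ 2) ^ 2 := by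
  obtain ⟨ht1, ht2⟩ := ht
  obtain ⟨v, hv⟩ : ∃ v, v = 1 / (1 / 4 + t ^ 2) := ⟨_, rfl⟩
  have hq : (1 / 4 + t ^ 2 : ℝ) ≠ 0 := by positivity
  have hv1 : 0.0249 ≤ v := by rw [hv, le_div_iff₀ (by positivity)]; nlinarith
  have hv2 : v ≤ 0.0253 := by rw [hv, div_le_iff₀ (by positivity)]; nlinarith
  constructor
  · rw [show -2 * l * (1 / 2 - 2 / (1 / 4 + t ^ 2) + 1 / 96)
        - 4 * (1 / 4 - t ^ 2) / (1 / 4 + t ^ 2) ^ 2 + 1 / 48 =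
        -l * (49 / 48) + 4 * (l * v) + 4 * v - 2 * v ^ 2 + 1 / 48 by rw [hv]; field_simp; ring]
    have : 0.69314 * 0.0249 ≤ l * v := by gcongr
    nlinarith
  · rw [show 2 * l * t * (4 / (1 / 4 + t ^ 2) - 1 / 48) - 4 * t / (1 / 4 + t ^ 2) ^ 2 =
        t * (2 * (l * (4 * v - 1 / 48)) - 4 * v ^ 2) by rw [hv]; field_simp]
    have : 0.69314 * (4 * 0.0249 - 1 / 48) ≤ l * (4 * v - 1 / 48) := by gcongr
    have : 0.1065 ≤ 2 * (l * (4 * v - 1 / 48)) - 4 * v ^ 2 := by nlinarith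
    nlinarith

set_option maxHeartbeats 1000000 in
lemma im_deriv_zetaMain_le {t : ℝ} (ht : t ∈ Set.Icc (6.27 : ℝ) 6.31) :
    (deriv zetaMain (1 / 2 + t * I)).im ≤ -0.07 := by
  obtain ⟨ht1, ht2⟩ := ht
  rw [im_deriv_zetaMain]
  have l2 := Real.log_two_gt_d9
  have l2' := Real.log_two_lt_d9
  have l3 := Real.log_three_gt_d9
  have l3' := Real.log_three_lt_d9
  have p1 := Real.pi_gt_d4
  have p2 := Real.pi_lt_d4
  obtain ⟨a, ha⟩ : ∃ a, a = Real.exp (-Real.log 2 / 2) := ⟨_, rfl⟩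
  have a0 : 0 < a := ha ▸ Real.exp_pos _
  have a2 : a ^ 2 = 1 / 2 := ha ▸ exp_neg_log_div_two_sq (by norm_num)
  obtain ⟨b, hb⟩ : ∃ b, b = Real.exp (-Real.log 3 / 2) := ⟨_, rfl⟩
  have b0 : 0 < b := hb ▸ Real.exp_pos _
  have b2 : b ^ 2 = 1 / 3 := hb ▸ exp_neg_log_div_two_sq (by norm_num)
  have ha7 : 0.707 ≤ a := by nlinarith
  have hb5 : b ≤ 0.5774 := by nlinarith
  obtain ⟨p, hp⟩ : ∃ p, p = 3 * Real.pi / 2 - t * Real.log 2 := ⟨_, rfl⟩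
  have hpl : 0.338 ≤ p := by rw [hp]; nlinarith
  have hpu : p ≤ 0.3665 := by rw [hp]; nlinarith
  have hsin2 : Real.sin (t * Real.log 2) = -Real.cos p := by
    rw [show t * Real.log 2 = Real.pi - (p - Real.pi / 2) by rw [hp]; ring, Real.sin_pi_sub,
      Real.sin_sub_pi_div_two]
  have hcos2 : Real.cos (t * Real.log 2) = -Real.sin p := by
    rw [show t * Real.log 2 = Real.pi - (p - Real.pi / 2) by rw [hp]; ring, Real.cos_pi_sub,
      Real.cos_sub_pi_div_two]
  obtain ⟨r, hr⟩ : ∃ r, r = t * Real.log 3 - 2 * Real.pi := ⟨_, rfl⟩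
  have hrl : 0.604 ≤ r := by rw [hr]; nlinarith
  have hru : r ≤ 0.65 := by rw [hr]; nlinarith
  have hsin3 : Real.sin (t * Real.log 3) = Real.sin r := by rw [hr, Real.sin_sub_two_pi]
  have hC1 : 0.932 ≤ Real.cos p := by
    have := Real.one_sub_sq_div_two_le_cos (x := p)
    nlinarith
  have hC2 := Real.cos_le_one p
  have hSC := Real.sin_sq_add_cos_sq p
  have hS0 : 0 ≤ Real.sin p := Real.sin_nonneg_of_nonneg_of_le_pi (by linarith)
    (by linarith)
  have hS1 : Real.sin p ≤ 0.3665 := (Real.sin_le (by linarith)).trans hpu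
  have hR : Real.sin r ≤ 0.61 := by
    have h1 := (abs_le.1 (Real.sin_bound (x := r) (by rw [abs_le]; constructor <;> linarith))).2
    have h2 : |r| ^ 5 ≤ 0.65 ^ 5 := by gcongr; rw [abs_le]; constructor <;> linarith
    have h3 : r - r ^ 3 / 6 ≤ 0.605 := by
        nlinarith [mul_nonneg (sub_nonneg.2 hrl) (sub_nonneg.2 hru)]
    linarith
  have hR0 : 0 ≤ Real.sin r := Real.sin_nonneg_of_nonneg_of_le_pi (by linarith)
    (by linarith)
  rw [hsin2, hcos2, hsin3, ← ha, ← hb]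
  set C := Real.cos p
  set S := Real.sin p
  obtain ⟨hD1l, hD2l⟩ := neg_le_and_le_of_mem_Icc ⟨ht1, ht2⟩ (l := Real.log 2)
    (by linarith) (by linarith)
  generalize -2 * Real.log 2 * (1 / 2 - 2 / (1 / 4 + t ^ 2) + 1 / 96)
      - 4 * (1 / 4 - t ^ 2) / (1 / 4 + t ^ 2) ^ 2 + 1 / 48 = D1 at *
  generalize 2 * Real.log 2 * t * (4 / (1 / 4 + t ^ 2) - 1 / 48)
      - 4 * t / (1 / 4 + t ^ 2) ^ 2 = D2 at *
  have t1 : 0.69314 * 0.707 * 0.932 ≤ Real.log 2 * a * C := by gcongr; linarith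
  have t2 : Real.log 3 * b * Real.sin r ≤ 1.0987 * 0.5774 * 0.61 := by gcongr; linarith
  have hCC : 0.932 ^ 2 ≤ C ^ 2 := by gcongr
  have t3 : 0.736 * 0.65 ≤ (C ^ 2 - S ^ 2) * D2 := by gcongr <;> linarith
  have t4 : C * S ≤ 1 * 0.3665 := by gcongr
  have t5 : 0 ≤ C * S * (D1 + 0.54) :=
    mul_nonneg (mul_nonneg (by linarith) hS0) (by linarith)
  linarith

lemma deriv_riemannZeta_ne_zero_of_mem_Icc {t : ℝ} (ht : t ∈ Set.Icc (6.27 : ℝ) 6.31) :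
    deriv riemannZeta (1 / 2 + t * I) ≠ 0 := fun h => by
  have h1 := norm_deriv_riemannZeta_sub_le ht
  rw [h, zero_sub, norm_neg] at h1
  have h2 := (abs_le.1 ((abs_im_le_norm _).trans h1)).1
  have h3 := im_deriv_zetaMain_le ht
  linarith

/-- On the critical line, `ζ'` can vanish only where `ζ` does. -/
lemma deriv_riemannZeta_ne_zero {t : ℝ} (h : riemannZeta (1 / 2 + t * I) ≠ 0) :
    deriv riemannZeta (1 / 2 + t * I) ≠ 0 := fun h' => by
  have ht := abs_mem_Icc_of_deriv_riemannZeta_eq_zero h h'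
  refine deriv_riemannZeta_ne_zero_of_mem_Icc ht ?_
  rcases abs_cases t with ⟨h1, -⟩ | ⟨h1, -⟩
  · rwa [h1]
  · have := deriv_riemannZeta_conj (1 / 2 + t * I)
    rw [h', map_zero] at this
    rw [h1, ← this]
    congr 1
    apply Complex.ext <;> simp

theorem zeta_locally_injective_of_ne_zero (t₀ : ℝ)
    (h : riemannZeta (1/2 + t₀ * I) ≠ 0) :
    ∃ ε > (0:ℝ), Set.InjOn (fun t : ℝ => riemannZeta (1/2 + t * I))
      (Set.Ioo (t₀ - ε) (t₀ + ε)) := by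
  have hs : (1 / 2 + t₀ * I : ℂ) ≠ 1 := fun h => by
    have := congrArg re h
    norm_num at this
  have hana : AnalyticAt ℂ riemannZeta (1 / 2 + t₀ * I) :=
    DifferentiableOn.analyticAt (s := {1}ᶜ)
      (fun s hs => (differentiableAt_riemannZeta hs).differentiableWithinAt)
      (isOpen_compl_singleton.mem_nhds hs)
  have hstrict := hana.contDiffAt.hasStrictDerivAt (n := 1) one_ne_zero
  have hev := (hstrict.hasStrictFDerivAt_equiv (deriv_riemannZeta_ne_zero h)).eventually_left_inverse
  have hcont : Continuous fun t : ℝ => (1 / 2 + t * I : ℂ) := by fun_prop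
  obtain ⟨ε, hε, hball⟩ := Metric.eventually_nhds_iff_ball.1 (hcont.continuousAt.eventually hev)
  refine ⟨ε, hε, fun x hx y hy hxy => ?_⟩
  rw [← Real.ball_eq_Ioo] at hx hy
  have hxy' := (hball x hx).symm.trans ((congrArg _ hxy).trans (hball y hy))
  simpa using hxy'
end

section
/- Let F, G be non-constant analytic functions in a neighborhood of 0 such that neither curve bounces back at zero. If there are sequences of positive reals u_k → 0⁺, v_k → 0⁺ with F(u_k) = G(v_k) for all k, then F and G share a curve around zero: there exist arbitrarily short open real intervals I, J containing 0 with F(I) = G(J). -/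
open Filter Metric Set

/-- The curve of `F` bounces back at zero: there are arbitrarily short open
intervals `I = (a, b)` containing `0` with `F(I ∩ [0,∞)) = F(I ∩ (-∞,0])`. -/
def BouncesBackAtZero (F : ℂ → ℂ) : Prop :=
  ∀ ε > (0:ℝ), ∃ a b : ℝ, a < 0 ∧ 0 < b ∧ b - a < ε ∧
    (fun t : ℝ => F t) '' Ico 0 b = (fun t : ℝ => F t) '' Ioc a 0

/-- `F` and `G` share a curve around zero: there are arbitrarily short open
intervals `I, J` containing `0` with `F(I) = G(J)`. -/
def ShareCurveAtZero (F G : ℂ → ℂ) : Prop :=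
  ∀ ε > (0:ℝ), ∃ a b c d : ℝ, a < 0 ∧ 0 < b ∧ b - a < ε ∧ c < 0 ∧ 0 < d ∧ d - c < ε ∧
    (fun t : ℝ => F t) '' Ioo a b = (fun t : ℝ => G t) '' Ioo c d

open Topology

lemma AnalyticAt.exists_pow_eq {k : ℂ → ℂ} {z₀ : ℂ} (hk : AnalyticAt ℂ k z₀) (hk0 : k z₀ ≠ 0)
    {N : ℕ} (hN : N ≠ 0) :
    ∃ r : ℂ → ℂ, AnalyticAt ℂ r z₀ ∧ r z₀ ≠ 0 ∧ ∀ z, r z ^ N = k z := by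
  refine ⟨fun z => (k z₀) ^ ((N : ℂ)⁻¹) * (k z / k z₀) ^ ((N : ℂ)⁻¹), ?_, ?_, fun z => ?_⟩
  · refine analyticAt_const.mul ((hk.div analyticAt_const hk0).cpow analyticAt_const ?_)
    simp [hk0]
  · simp [hk0]
  · rw [mul_pow, Complex.cpow_nat_inv_pow _ hN, Complex.cpow_nat_inv_pow _ hN]
    field_simp

/-- After a substitution `z = x ^ q`, a non-constant analytic function is, up to a constant,
the `n * q`-th power of a local coordinate, where `n` is its order at `0`. -/
lemma AnalyticAt.exists_comp_pow_sub_eq_pow {f : ℂ → ℂ} (hf : AnalyticAt ℂ f 0)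
    (hne : ¬ ∀ᶠ z in 𝓝 0, f z = f 0) :
    ∃ n : ℕ, n ≠ 0 ∧ ∀ q : ℕ, q ≠ 0 → ∃ Φ : ℂ → ℂ, AnalyticAt ℂ Φ 0 ∧ Φ 0 = 0 ∧
      deriv Φ 0 ≠ 0 ∧ ∀ᶠ x in 𝓝 0, f (x ^ q) - f 0 = Φ x ^ (n * q) := by
  have hf' : AnalyticAt ℂ (fun z => f z - f 0) 0 := hf.sub analyticAt_const
  obtain ⟨n, g, hg, hg0, hfg⟩ := hf'.exists_eventuallyEq_pow_smul_nonzero_iff.2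
    (by simpa [sub_eq_zero] using hne)
  simp only [sub_zero, smul_eq_mul] at hfg
  have hn : n ≠ 0 := by
    rintro rfl
    have := hfg.self_of_nhds
    simp at this
    exact hg0 this.symm
  refine ⟨n, hn, fun q hq => ?_⟩
  have hq0 : (0 : ℂ) ^ q = 0 := zero_pow hq
  have hpow : AnalyticAt ℂ (fun x : ℂ => x ^ q) 0 := analyticAt_id.pow q
  have hgq : AnalyticAt ℂ (fun x : ℂ => g (x ^ q)) 0 :=
    AnalyticAt.fun_comp (by simpa [hq0] using hg) hpow
  obtain ⟨r, hr, hr0, hrN⟩ := hgq.exists_pow_eq (by simpa [hq0] using hg0) (mul_ne_zero hn hq)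
  refine ⟨fun x => x * r x, analyticAt_id.mul hr, by simp, ?_, ?_⟩
  · have : HasDerivAt (fun x => x * r x) (1 * r 0 + 0 * deriv r 0) 0 :=
      (hasDerivAt_id (0 : ℂ)).mul hr.differentiableAt.hasDerivAt
    rw [this.deriv]
    simpa using hr0
  · have ht : Tendsto (fun x : ℂ => x ^ q) (𝓝 0) (𝓝 0) := by
      simpa [hq0] using hpow.continuousAt.tendsto
    filter_upwards [ht.eventually hfg] with x hx
    rw [hx, mul_pow, hrN, ← pow_mul, mul_comm q n]

/-- An analytic function which is positive at infinitely many points of a positive sequence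
tending to `0`
is real and increasing on the real line near `0`, provided its derivative does not vanish. -/
lemma AnalyticAt.exists_real_of_frequently {h : ℂ → ℂ} (hh : AnalyticAt ℂ h 0)
    (h0 : h 0 = 0) (hd : deriv h 0 ≠ 0) {x y : ℕ → ℝ} (hx : ∀ k, 0 < x k) (hy : ∀ k, 0 < y k)
    (hx0 : Tendsto x atTop (𝓝 0)) (hxy : ∃ᶠ k in atTop, h (x k) = y k) :
    ∃ g : ℝ → ℝ, AnalyticAt ℝ g 0 ∧ g 0 = 0 ∧ 0 < deriv g 0 ∧
      ∀ᶠ t : ℝ in 𝓝 0, h t = g t := by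
  have hre : AnalyticAt ℝ (fun t : ℝ => (h t).re) 0 := AnalyticAt.re_ofReal (by simpa using hh)
  have him : AnalyticAt ℝ (fun t : ℝ => (h t).im) 0 := AnalyticAt.im_ofReal (by simpa using hh)
  have hx0' : Tendsto x atTop (𝓝[>] 0) :=
    tendsto_nhdsWithin_iff.2 ⟨hx0, .of_forall hx⟩
  have hreal : ∀ᶠ t : ℝ in 𝓝 0, h t = (h t).re := by
    have := him.frequently_zero_iff_eventually_zero.1
      ((hx0'.mono_right (nhdsWithin_mono _ fun t ht => ne_of_gt ht)).frequently
        (hxy.mono fun k hk => by simp [hk]))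
    filter_upwards [this] with t ht
    apply Complex.ext <;> simp [ht]
  have hD : HasDerivAt (fun t : ℝ => h t) (deriv h 0) 0 :=
    HasDerivAt.comp_ofReal (z := 0) (by simpa using hh.differentiableAt.hasDerivAt)
  have hD' : HasDerivAt (fun t : ℝ => ((h t).re : ℂ)) (deriv (fun t : ℝ => (h t).re) 0 : ℝ) 0 :=
    hre.differentiableAt.hasDerivAt.ofReal_comp
  have hderiv : deriv h 0 = (deriv (fun t : ℝ => (h t).re) 0 : ℝ) :=
    (hD.congr_of_eventuallyEq (hreal.mono fun t ht => ht.symm)).unique hD'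
  refine ⟨fun t => (h t).re, hre, by simp [h0], lt_of_le_of_ne ?_ ?_, hreal⟩
  · have hs := (hasDerivAt_iff_tendsto_slope.1 hre.differentiableAt.hasDerivAt).comp
      (hx0'.mono_right (nhdsWithin_mono _ fun t ht => ne_of_gt ht))
    refine ge_of_tendsto_of_frequently hs (hxy.mono fun k hk => ?_)
    simp [slope_def_field, h0, hk, (div_pos (hy k) (hx k)).le]
  · intro h'
    exact hd (by rw [hderiv, ← h']; simp)

/-- If two local coordinates have equal `N`-th powers along positive real sequences tending to `0`,
then they have equal `N`-th powers along an increasing real-analytic reparametrization. -/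
lemma exists_real_reparametrization {Φ Γ : ℂ → ℂ} (hΦ : AnalyticAt ℂ Φ 0) (hΓ : AnalyticAt ℂ Γ 0)
    (hΦ0 : Φ 0 = 0) (hΓ0 : Γ 0 = 0) (hΦd : deriv Φ 0 ≠ 0) (hΓd : deriv Γ 0 ≠ 0)
    {N : ℕ} (hN : N ≠ 0) {x y : ℕ → ℝ} (hx : ∀ k, 0 < x k) (hy : ∀ k, 0 < y k)
    (hx0 : Tendsto x atTop (𝓝 0)) (hy0 : Tendsto y atTop (𝓝 0))
    (hxy : ∀ᶠ k in atTop, Φ (x k) ^ N = Γ (y k) ^ N) :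
    ∃ g : ℝ → ℝ, AnalyticAt ℝ g 0 ∧ g 0 = 0 ∧ 0 < deriv g 0 ∧
      ∀ᶠ t : ℝ in 𝓝 0, Φ t ^ N = Γ (g t) ^ N := by
  obtain ⟨ζ, hζ, hfreq⟩ : ∃ ζ : ℂ, ζ ^ N = 1 ∧ ∃ᶠ k in atTop, Φ (x k) = ζ * Γ (y k) := by
    have hmem : ∃ᶠ k in atTop, ∃ ζ ∈ Polynomial.nthRootsFinset N (1 : ℂ),
        Φ (x k) = ζ * Γ (y k) := by
      refine (hxy.mono fun k hk => ?_).frequently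
      simp only [Polynomial.mem_nthRootsFinset (Nat.pos_of_ne_zero hN)]
      by_cases hz : Γ (y k) = 0
      · exact ⟨1, by simp, by simpa [hz, hN] using hk⟩
      · exact ⟨Φ (x k) / Γ (y k), by rw [div_pow, hk, div_self (pow_ne_zero _ hz)],
          by field_simp⟩
    obtain ⟨ζ, hζ, h⟩ := (frequently_exists_finset _).1 hmem
    exact ⟨ζ, (Polynomial.mem_nthRootsFinset (Nat.pos_of_ne_zero hN) _).1 hζ, h⟩
  have hζ0 : ζ ≠ 0 := by
    rintro rfl
    simp [hN] at hζ
  have hA : AnalyticAt ℂ (fun z => ζ * Γ z) 0 := analyticAt_const.mul hΓ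
  have hAd : deriv (fun z => ζ * Γ z) 0 ≠ 0 := by
    rw [deriv_const_mul _ hΓ.differentiableAt]
    exact mul_ne_zero hζ0 hΓd
  set ψ := hA.hasStrictDerivAt.localInverse _ _ _ hAd with hψ
  have hψa : AnalyticAt ℂ ψ 0 := by simpa [hΓ0] using hA.analyticAt_localInverse hAd
  have hleft : ∀ᶠ z in 𝓝 0, ψ (ζ * Γ z) = z :=
    hA.hasStrictDerivAt.eventually_left_inverse hAd
  have hright : ∀ᶠ w in 𝓝 0, ζ * Γ (ψ w) = w := by
    have := hA.hasStrictDerivAt.eventually_right_inverse hAd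
    simp only [hΓ0, mul_zero] at this
    exact this
  have hψd : deriv ψ 0 ≠ 0 := by
    have := (hA.hasStrictDerivAt.to_localInverse hAd).hasDerivAt.deriv
    simp only [hΓ0, mul_zero] at this
    rw [hψ, this]
    exact inv_ne_zero hAd
  have hψ0 : ψ 0 = 0 := by simpa [hΓ0] using hleft.self_of_nhds
  have hψΦ : AnalyticAt ℂ (fun z => ψ (Φ z)) 0 := AnalyticAt.fun_comp (by rwa [hΦ0]) hΦ
  have hψΦd : deriv (fun z => ψ (Φ z)) 0 ≠ 0 := by
    have : HasDerivAt (fun z => ψ (Φ z)) (deriv ψ 0 * deriv Φ 0) 0 :=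
      HasDerivAt.comp (h₂ := ψ) 0 (by simpa [hΦ0] using hψa.differentiableAt.hasDerivAt)
        hΦ.differentiableAt.hasDerivAt
    rw [this.deriv]
    exact mul_ne_zero hψd hΦd
  have hcoe : Tendsto (fun t : ℝ => (t : ℂ)) (𝓝 0) (𝓝 0) := by
    simpa using Complex.continuous_ofReal.tendsto 0
  obtain ⟨g, hg, hg0, hgd, hgh⟩ := hψΦ.exists_real_of_frequently (by simp [hΦ0, hψ0]) hψΦd hx hy hx0
    ((hfreq.and_eventually ((hcoe.comp hy0).eventually hleft)).mono fun k hk => by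
      simpa [hk.1] using hk.2)
  refine ⟨g, hg, hg0, hgd, ?_⟩
  have hΦt : Tendsto Φ (𝓝 0) (𝓝 0) := by simpa [hΦ0] using hΦ.continuousAt.tendsto
  filter_upwards [hgh, (hΦt.comp hcoe).eventually hright] with t ht ht'
  simp only [Function.comp_apply] at ht'
  rw [← ht, ← one_mul (Γ _ ^ N), ← hζ, ← mul_pow, ht']

/-- If the curve of `F` along an odd power agrees with the curve of `G` along an even
power, up to increasing reparametrizations, then the curve of `F` bounces back. -/
lemma bouncesBackAtZero_of_odd_even {F G : ℂ → ℂ} {f g : ℝ → ℝ} {p q : ℕ} (hp : Even p)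
    (hq : Odd q) {δ : ℝ} (hδ : 0 < δ)
    (hf : ContinuousOn f (Icc (-δ) δ)) (hg : ContinuousOn g (Icc (-δ) δ))
    (hfm : StrictMonoOn f (Icc (-δ) δ)) (hgm : StrictMonoOn g (Icc (-δ) δ))
    (hf0 : f 0 = 0) (hg0 : g 0 = 0)
    (hFG : ∀ t ∈ Icc (-δ) δ, F (f t ^ q : ℝ) = G (g t ^ p : ℝ)) : BouncesBackAtZero F := by
  intro ε hε
  have hα : ContinuousOn (fun t => f t ^ q) (Icc (-δ) δ) := hf.pow q
  have hαm : StrictMonoOn (fun t => f t ^ q) (Icc (-δ) δ) :=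
    hq.strictMono_pow.comp_strictMonoOn hfm
  have hα0 : f 0 ^ q = 0 := by simp [hf0, hq.pos.ne']
  obtain ⟨η, hη, hηδ, hsmall⟩ :
      ∃ η > 0, η ≤ δ ∧ ∀ t ∈ Icc (-η) η, |f t ^ q| < ε / 2 := by
    have hc : ContinuousAt (fun t => f t ^ q) 0 :=
      hα.continuousAt (Icc_mem_nhds (by linarith) hδ)
    obtain ⟨d, hd, hd'⟩ := Metric.continuousAt_iff.1 hc (ε / 2) (by positivity)
    refine ⟨min δ (d / 2), by positivity, min_le_left _ _, fun t ht => ?_⟩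
    have h2 := min_le_right δ (d / 2)
    have := @hd' t (by
      rw [Real.dist_eq, sub_zero, abs_lt]
      constructor <;> linarith [ht.1, ht.2])
    simpa [Real.dist_eq, hα0] using this
  have h0δ : (0 : ℝ) ∈ Icc (-δ) δ := ⟨by linarith, hδ.le⟩
  have hgη : 0 < g η := by
    have := hgm h0δ ⟨by linarith, hηδ⟩ hη
    rwa [hg0] at this
  have hgη' : g (-η) < 0 := by
    have := hgm ⟨by linarith, by linarith⟩ h0δ (neg_lt_zero.2 hη)
    rwa [hg0] at this
  set ξ := min (g η) (-g (-η)) with hξ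
  have hξ0 : 0 < ξ := lt_min hgη (by linarith)
  obtain ⟨a, ha, hga⟩ : ∃ a ∈ Icc 0 η, g a = ξ :=
    intermediate_value_Icc hη.le (hg.mono (Icc_subset_Icc (by linarith) hηδ))
      ⟨by rw [hg0]; exact hξ0.le, min_le_left _ _⟩
  obtain ⟨b, hb, hgb⟩ : ∃ b ∈ Icc (-η) 0, g b = -ξ :=
    intermediate_value_Icc (by linarith) (hg.mono (Icc_subset_Icc (by linarith) hδ.le))
      ⟨by linarith [min_le_right (g η) (-g (-η))], by rw [hg0]; linarith⟩
  have ha0 : 0 < a := lt_of_le_of_ne ha.1 (by rintro rfl; linarith)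
  have hb0 : b < 0 := lt_of_le_of_ne hb.2 (by rintro rfl; linarith)
  have hsa : Icc 0 a ⊆ Icc (-δ) δ := Icc_subset_Icc (by linarith) (by linarith [ha.2])
  have hsb : Icc b 0 ⊆ Icc (-δ) δ := Icc_subset_Icc (by linarith [hb.1]) (by linarith)
  have hαa : 0 < f a ^ q := by
    have := hαm h0δ (hsa ⟨ha0.le, le_rfl⟩) ha0
    simpa only [hα0] using this
  have hαb : f b ^ q < 0 := by
    have := hαm (hsb ⟨le_rfl, hb0.le⟩) h0δ hb0
    simpa only [hα0] using this
  refine ⟨f b ^ q, f a ^ q, hαb, hαa, ?_, ?_⟩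
  · have h1 := (abs_lt.1 (hsmall a ⟨by linarith, ha.2⟩)).2
    have h2 := (abs_lt.1 (hsmall b ⟨hb.1, by linarith⟩)).1
    linarith
  have e1 := (hα.mono hsa).image_Ico_of_strictMonoOn ha0.le (hαm.mono hsa)
  have e2 := (hα.mono hsb).image_Ioc_of_strictMonoOn hb0.le (hαm.mono hsb)
  have e3 := (hg.mono hsa).image_Ico_of_strictMonoOn ha0.le (hgm.mono hsa)
  have e4 := (hg.mono hsb).image_Ioc_of_strictMonoOn hb0.le (hgm.mono hsb)
  simp only [hα0] at e1 e2
  rw [hg0, hga] at e3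
  rw [hg0, hgb] at e4
  have key : ∀ s ⊆ Icc (-δ) δ, (fun t : ℝ => F t) '' ((fun t => f t ^ q) '' s) =
      (fun t : ℝ => G (t ^ p : ℝ)) '' (g '' s) := by
    intro s hs
    rw [image_image, image_image]
    exact image_congr fun t ht => hFG t (hs ht)
  rw [← e1, ← e2, key _ (Ico_subset_Icc_self.trans hsa), key _ (Ioc_subset_Icc_self.trans hsb),
    e3, e4, ← neg_zero, ← image_neg_Ico, image_image, neg_zero]
  exact image_congr fun t _ => by simp [hp.neg_pow]

/-- If the curves of `F` and `G` agree along odd powers, up to increasing reparametrizations,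
then `F` and `G` share a curve around zero. -/
lemma shareCurveAtZero_of_odd_odd {F G : ℂ → ℂ} {f g : ℝ → ℝ} {p q : ℕ} (hp : Odd p)
    (hq : Odd q) {δ : ℝ} (hδ : 0 < δ)
    (hf : ContinuousOn f (Icc (-δ) δ)) (hg : ContinuousOn g (Icc (-δ) δ))
    (hfm : StrictMonoOn f (Icc (-δ) δ)) (hgm : StrictMonoOn g (Icc (-δ) δ))
    (hf0 : f 0 = 0) (hg0 : g 0 = 0)
    (hFG : ∀ t ∈ Icc (-δ) δ, F (f t ^ q : ℝ) = G (g t ^ p : ℝ)) : ShareCurveAtZero F G := by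
  intro ε hε
  have h0δ : (0 : ℝ) ∈ Icc (-δ) δ := ⟨by linarith, hδ.le⟩
  have main : ∀ (f : ℝ → ℝ) (q : ℕ), Odd q → ContinuousOn f (Icc (-δ) δ) →
      StrictMonoOn f (Icc (-δ) δ) → f 0 = 0 → ∀ᶠ η in 𝓝[>] (0 : ℝ),
        f (-η) ^ q < 0 ∧ 0 < f η ^ q ∧ f η ^ q - f (-η) ^ q < ε ∧
        (fun t => f t ^ q) '' Ioo (-η) η = Ioo (f (-η) ^ q) (f η ^ q) := by
    intro f q hq hf hfm hf0
    have hα : ContinuousOn (fun t => f t ^ q) (Icc (-δ) δ) := hf.pow q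
    have hαm : StrictMonoOn (fun t => f t ^ q) (Icc (-δ) δ) :=
      hq.strictMono_pow.comp_strictMonoOn hfm
    have hα0 : f 0 ^ q = 0 := by simp [hf0, hq.pos.ne']
    have hc : ContinuousAt (fun t => f t ^ q) 0 :=
      hα.continuousAt (Icc_mem_nhds (by linarith) hδ)
    have hc' : ContinuousAt (fun t => f (-t) ^ q) 0 :=
      ContinuousAt.comp (f := fun t : ℝ => -t) (g := fun t => f t ^ q) (by simpa using hc)
        continuous_neg.continuousAt
    have hlt : ∀ᶠ η in 𝓝 (0 : ℝ), f η ^ q - f (-η) ^ q < ε :=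
      (hc.sub hc').eventually_lt_const (by simpa [hα0] using hε)
    filter_upwards [hlt.filter_mono nhdsWithin_le_nhds, Ioo_mem_nhdsGT hδ] with η hη hηδ
    have hs : Icc (-η) η ⊆ Icc (-δ) δ := Icc_subset_Icc (by linarith [hηδ.2]) hηδ.2.le
    have hη0 := hηδ.1
    refine ⟨?_, ?_, hη, (hα.mono hs).image_Ioo_of_strictMonoOn (by linarith) (hαm.mono hs)⟩
    · have := hαm (hs ⟨le_rfl, by linarith⟩) h0δ (neg_lt_zero.2 hη0)
      simpa only [hα0] using this
    · have := hαm h0δ (hs ⟨by linarith, le_rfl⟩) hη0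
      simpa only [hα0] using this
  obtain ⟨η, ⟨ha, hb, hab, hI⟩, ⟨hc, hd, hcd, hJ⟩, hη⟩ :=
    ((main f q hq hf hfm hf0).and
      ((main g p hp hg hgm hg0).and (Ioo_mem_nhdsGT hδ))).exists
  refine ⟨_, _, _, _, ha, hb, hab, hc, hd, hcd, ?_⟩
  rw [← hI, ← hJ, image_image, image_image]
  exact image_congr fun t ht => hFG t ⟨by linarith [ht.1, hη.2], by linarith [ht.2, hη.2]⟩

lemma AnalyticAt.eventually_continuousAt_and_deriv_pos {g : ℝ → ℝ} {t₀ : ℝ} (hg : AnalyticAt ℝ g t₀)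
    (hd : 0 < deriv g t₀) : ∀ᶠ s in 𝓝 t₀, ContinuousAt g s ∧ 0 < deriv g s :=
  (hg.eventually_analyticAt.mono fun _ h => h.continuousAt).and
    (hg.deriv.continuousAt.eventually (lt_mem_nhds hd))

lemma AnalyticOnNhd.not_eventually_eq_const_of_ball {F : ℂ → ℂ} {r : ℝ} (hr : 0 < r)
    (hF : AnalyticOnNhd ℂ F (ball 0 r)) (hFnc : ∃ z ∈ ball (0 : ℂ) r, F z ≠ F 0) :
    ¬ ∀ᶠ z in 𝓝 0, F z = F 0 := by
  obtain ⟨z, hz, hne⟩ := hFnc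
  exact fun h => hne <| hF.eqOn_of_preconnected_of_eventuallyEq analyticOnNhd_const
    (convex_ball _ _).isPreconnected (mem_ball_self hr) h hz

theorem share_curve_of_rough_agreement_right
    (F G : ℂ → ℂ) (r : ℝ) (hr : 0 < r)
    (hF : AnalyticOnNhd ℂ F (ball 0 r)) (hG : AnalyticOnNhd ℂ G (ball 0 r))
    (hFnc : ∃ z ∈ ball (0:ℂ) r, F z ≠ F 0) (hGnc : ∃ z ∈ ball (0:ℂ) r, G z ≠ G 0)
    (hFnb : ¬ BouncesBackAtZero F) (hGnb : ¬ BouncesBackAtZero G)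
    (u v : ℕ → ℝ) (hu : ∀ k, 0 < u k) (hv : ∀ k, 0 < v k)
    (hu0 : Tendsto u atTop (nhds 0)) (hv0 : Tendsto v atTop (nhds 0))
    (heq : ∀ k, F (u k) = G (v k)) :
    ShareCurveAtZero F G := by
  have h0 : (0 : ℂ) ∈ ball (0 : ℂ) r := mem_ball_self hr
  have hcoe : Tendsto (fun t : ℝ => (t : ℂ)) (𝓝 0) (𝓝 0) := by
    simpa using Complex.continuous_ofReal.tendsto 0
  have hFG0 : F 0 = G 0 := by
    have h1 := (hF 0 h0).continuousAt.tendsto.comp (hcoe.comp hu0)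
    have h2 := (hG 0 h0).continuousAt.tendsto.comp (hcoe.comp hv0)
    exact tendsto_nhds_unique h1 (h2.congr fun k => (heq k).symm)
  obtain ⟨n, hn, hFn⟩ := (hF 0 h0).exists_comp_pow_sub_eq_pow
    (hF.not_eventually_eq_const_of_ball hr hFnc)
  obtain ⟨m, hm, hGm⟩ := (hG 0 h0).exists_comp_pow_sub_eq_pow
    (hG.not_eventually_eq_const_of_ball hr hGnc)
  obtain ⟨p, q, hpq, hp0, hq0, hN⟩ :
      ∃ p q : ℕ, p.Coprime q ∧ p ≠ 0 ∧ q ≠ 0 ∧ n * q = m * p := by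
    have hd : 0 < n.gcd m := Nat.gcd_pos_of_pos_left _ (Nat.pos_of_ne_zero hn)
    refine ⟨n / n.gcd m, m / n.gcd m, Nat.coprime_div_gcd_div_gcd hd,
      (Nat.div_pos (Nat.gcd_le_left _ (Nat.pos_of_ne_zero hn)) hd).ne',
      (Nat.div_pos (Nat.gcd_le_right _ (Nat.pos_of_ne_zero hm)) hd).ne', ?_⟩
    rw [← Nat.mul_div_assoc _ (Nat.gcd_dvd_right n m), ← Nat.mul_div_assoc _ (Nat.gcd_dvd_left n m),
      mul_comm]
  obtain ⟨Φ, hΦ, hΦ0, hΦd, hΦF⟩ := hFn q hq0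
  obtain ⟨Γ, hΓ, hΓ0, hΓd, hΓG⟩ := hGm p hp0
  have hroot : ∀ (w : ℕ → ℝ) (l : ℕ), l ≠ 0 → (∀ k, 0 < w k) → Tendsto w atTop (𝓝 0) →
      ∃ x : ℕ → ℝ, (∀ k, 0 < x k) ∧ Tendsto x atTop (𝓝 0) ∧ ∀ k, x k ^ l = w k := by
    intro w l hl hw hw0
    refine ⟨fun k => w k ^ ((l : ℝ)⁻¹), fun k => Real.rpow_pos_of_pos (hw k) _, ?_,
      fun k => Real.rpow_inv_natCast_pow (hw k).le hl⟩
    have hl' : 0 < (l : ℝ)⁻¹ := by positivity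
    simpa [Real.zero_rpow hl'.ne'] using hw0.rpow_const (p := (l : ℝ)⁻¹) (Or.inr hl'.le)
  obtain ⟨x, hx, hx0, hxu⟩ := hroot u q hq0 hu hu0
  obtain ⟨y, hy, hy0, hyv⟩ := hroot v p hp0 hv hv0
  obtain ⟨g, hg, hg0, hgd, hgΦ⟩ := exists_real_reparametrization hΦ hΓ hΦ0 hΓ0 hΦd hΓd
    (mul_ne_zero hn hq0) hx hy hx0 hy0 (by
      filter_upwards [(hcoe.comp hx0).eventually hΦF, (hcoe.comp hy0).eventually hΓG] with k h1 h2
      simp only [Function.comp_apply, ← Complex.ofReal_pow, hxu, hyv] at h1 h2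
      rw [← h1, hN, ← h2, heq, hFG0])
  have hgt : Tendsto g (𝓝 0) (𝓝 0) := by simpa [hg0] using hg.continuousAt.tendsto
  have hloc : ∀ᶠ t in 𝓝 (0 : ℝ), F (t ^ q : ℝ) = G (g t ^ p : ℝ) := by
    filter_upwards [hgΦ, hcoe.eventually hΦF, (hcoe.comp hgt).eventually hΓG] with t h1 h2 h3
    simp only [Function.comp_apply] at h3
    push_cast
    rw [h1, hN, ← h3, hFG0] at h2
    exact sub_left_injective h2
  obtain ⟨d, hd, hball⟩ := Metric.eventually_nhds_iff.1
    (hloc.and (hg.eventually_continuousAt_and_deriv_pos hgd))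
  have hδ : 0 < d / 2 := by positivity
  have hI : ∀ t ∈ Icc (-(d / 2)) (d / 2), _ := fun t ht => hball (y := t) (by
    rw [Real.dist_eq, sub_zero, abs_lt]
    constructor <;> linarith [ht.1, ht.2])
  have hgc : ContinuousOn g (Icc (-(d / 2)) (d / 2)) :=
    fun t ht => (hI t ht).2.1.continuousWithinAt
  have hgm : StrictMonoOn g (Icc (-(d / 2)) (d / 2)) :=
    strictMonoOn_of_deriv_pos (convex_Icc _ _) hgc fun t ht => (hI t (interior_subset ht)).2.2
  rcases Nat.even_or_odd p with hp | hp
  · have hq : Odd q := Nat.not_even_iff_odd.1 fun hq =>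
      Nat.not_coprime_of_dvd_of_dvd one_lt_two hp.two_dvd hq.two_dvd hpq
    exact absurd (bouncesBackAtZero_of_odd_even hp hq hδ continuousOn_id hgc
      (strictMono_id.strictMonoOn _) hgm rfl hg0 fun t ht => (hI t ht).1) hFnb
  rcases Nat.even_or_odd q with hq | hq
  · exact absurd (bouncesBackAtZero_of_odd_even hq hp hδ hgc continuousOn_id
      hgm (strictMono_id.strictMonoOn _) hg0 rfl fun t ht => (hI t ht).1.symm) hGnb
  · exact shareCurveAtZero_of_odd_odd hp hq hδ continuousOn_id hgc
      (strictMono_id.strictMonoOn _) hgm rfl hg0 fun t ht => (hI t ht).1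
end

section
/- Let F, G be non-constant analytic functions in a neighborhood of 0 such that neither curve bounces back at zero. Then the following are equivalent: (i) there are sequences of nonzero reals u_k → 0, v_k → 0 with F(u_k) = G(v_k) for all k; (ii) there are arbitrarily short open intervals I, J containing 0 with F(I) = G(J). -/
open Filter Metric Set

open Topology

theorem AnalyticAt.exists_pow_eventuallyEq {g : ℂ → ℂ} {z₀ : ℂ} (hg : AnalyticAt ℂ g z₀)
    (h0 : g z₀ ≠ 0) {L : ℕ} (hL : L ≠ 0) :
    ∃ ρ : ℂ → ℂ, AnalyticAt ℂ ρ z₀ ∧ ρ z₀ ≠ 0 ∧ ∀ᶠ z in 𝓝 z₀, g z = ρ z ^ L := by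
  obtain ⟨c, hc⟩ := IsAlgClosed.exists_pow_nat_eq (g z₀) (Nat.pos_of_ne_zero hL)
  have hc0 : c ≠ 0 := by
    rintro rfl
    exact h0 (by rw [← hc, zero_pow hL])
  have hq : AnalyticAt ℂ (fun z => g z / g z₀) z₀ := hg.div analyticAt_const h0
  have hlog : AnalyticAt ℂ (fun z => Complex.log (g z / g z₀)) z₀ :=
    hq.clog (by simp [h0])
  refine ⟨fun z => c * Complex.exp (Complex.log (g z / g z₀) / L),
    analyticAt_const.mul (hlog.div analyticAt_const (by exact_mod_cast hL)).cexp',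
    mul_ne_zero hc0 (Complex.exp_ne_zero _), ?_⟩
  filter_upwards [hg.continuousAt.eventually_ne h0] with z hz
  rw [mul_pow, hc, ← Complex.exp_nat_mul, mul_div_cancel₀ _ (by exact_mod_cast hL),
    Complex.exp_log (div_ne_zero hz h0), mul_div_cancel₀ _ h0]

theorem analyticOrderNatAt_sub_ne_zero {F : ℂ → ℂ} (hF : AnalyticAt ℂ F 0)
    (hnc : ¬ ∀ᶠ z in 𝓝 0, F z = F 0) : analyticOrderNatAt (fun z => F z - F 0) 0 ≠ 0 := by
  have hsub : AnalyticAt ℂ (fun z => F z - F 0) 0 := hF.sub analyticAt_const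
  have htop : analyticOrderAt (fun z => F z - F 0) 0 ≠ ⊤ := by
    simpa only [ne_eq, analyticOrderAt_eq_top, sub_eq_zero] using hnc
  intro h
  rw [analyticOrderNatAt, ENat.toNat_eq_zero, or_iff_left htop, hsub.analyticOrderAt_eq_zero] at h
  exact h (sub_self _)

/-- If `F - F 0` vanishes to order `m` at `0`, then `F (s ^ n) - F 0` is the `m * n`-th power of a
local coordinate. -/
theorem AnalyticAt.exists_coordinate_pow_comp_pow {F : ℂ → ℂ} (hF : AnalyticAt ℂ F 0)
    (hnc : ¬ ∀ᶠ z in 𝓝 0, F z = F 0) {n : ℕ} (hn : n ≠ 0) :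
    ∃ p : ℂ → ℂ, AnalyticAt ℂ p 0 ∧ p 0 = 0 ∧ deriv p 0 ≠ 0 ∧
      ∀ᶠ s in 𝓝 0, F (s ^ n) - F 0 = p s ^ (analyticOrderNatAt (fun z => F z - F 0) 0 * n) := by
  have hm := analyticOrderNatAt_sub_ne_zero hF hnc
  have hsub : AnalyticAt ℂ (fun z => F z - F 0) 0 := hF.sub analyticAt_const
  obtain ⟨g, hg, hg0, hFg⟩ := hsub.analyticOrderAt_ne_top.1
    (by simpa only [ne_eq, analyticOrderAt_eq_top, sub_eq_zero] using hnc)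
  set m := analyticOrderNatAt (fun z => F z - F 0) 0
  have hpow : AnalyticAt ℂ (fun s : ℂ => s ^ n) 0 := analyticAt_id.pow n
  have hpow0 : (0 : ℂ) ^ n = 0 := zero_pow hn
  obtain ⟨ρ, hρ, hρ0, hgρ⟩ := AnalyticAt.exists_pow_eventuallyEq (g := fun s => g (s ^ n)) (z₀ := 0)
    (AnalyticAt.fun_comp (by rwa [hpow0]) hpow) (by rwa [hpow0]) (mul_ne_zero hm hn)
  refine ⟨fun s => s * ρ s, analyticAt_id.mul hρ, by simp, ?_, ?_⟩
  · have := ((hasDerivAt_id (0 : ℂ)).mul hρ.differentiableAt.hasDerivAt).deriv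
    simp only [id, one_mul, zero_mul, add_zero] at this
    have h2 : deriv (fun s => s * ρ s) 0 = ρ 0 := this
    rwa [h2]
  · have ht : Tendsto (fun s : ℂ => s ^ n) (𝓝 0) (𝓝 0) := by
      simpa [hpow0] using hpow.continuousAt.tendsto
    filter_upwards [ht.eventually hFg, hgρ] with s h1 h2
    rw [h1, h2, mul_pow, sub_zero, smul_eq_mul, ← pow_mul, mul_comm n m]

/-- Two local coordinates whose powers agree along positive reals tending to `0` are related by a
real change of coordinates. -/
theorem exists_real_change_of_coordinates {p q : ℂ → ℂ} (hp : AnalyticAt ℂ p 0)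
    (hq : AnalyticAt ℂ q 0) (hp0 : p 0 = 0) (hq0 : q 0 = 0) (hp' : deriv p 0 ≠ 0)
    (hq' : deriv q 0 ≠ 0) {L : ℕ} (hL : L ≠ 0)
    (hpq : ∃ᶠ x : ℝ × ℝ in 𝓝[>] 0 ×ˢ 𝓝[>] 0, p x.1 ^ L = q x.2 ^ L) :
    ∃ H : ℝ → ℝ, AnalyticAt ℝ H 0 ∧ H 0 = 0 ∧ 0 < deriv H 0 ∧
      ∀ᶠ s : ℝ in 𝓝 0, p s ^ L = q (H s) ^ L := by
  have hfst : Tendsto (fun x : ℝ × ℝ => (x.1 : ℂ)) (𝓝[>] 0 ×ˢ 𝓝[>] 0) (𝓝 0) := by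
    have : Tendsto (fun s : ℝ => (s : ℂ)) (𝓝 0) (𝓝 0) := by
      simpa using Complex.continuous_ofReal.tendsto 0
    exact this.comp (tendsto_fst.mono_right nhdsWithin_le_nhds)
  have hsnd : Tendsto (fun x : ℝ × ℝ => (x.2 : ℂ)) (𝓝[>] 0 ×ˢ 𝓝[>] 0) (𝓝 0) := by
    have : Tendsto (fun s : ℝ => (s : ℂ)) (𝓝 0) (𝓝 0) := by
      simpa using Complex.continuous_ofReal.tendsto 0
    exact this.comp (tendsto_snd.mono_right nhdsWithin_le_nhds)
  obtain ⟨ζ, hζL, hζ⟩ : ∃ ζ : ℂ, ζ ^ L = 1 ∧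
      ∃ᶠ x : ℝ × ℝ in 𝓝[>] 0 ×ˢ 𝓝[>] 0, q x.2 = ζ * p x.1 := by
    by_contra! hcon
    have hfin : {ζ : ℂ | ζ ^ L = 1}.Finite := by
      refine (Polynomial.nthRootsFinset L (1 : ℂ)).finite_toSet.subset fun ζ hζ => ?_
      simpa [Polynomial.mem_nthRootsFinset (Nat.pos_of_ne_zero hL)] using hζ
    have hall : ∀ᶠ x : ℝ × ℝ in 𝓝[>] 0 ×ˢ 𝓝[>] 0, ∀ ζ ∈ {ζ : ℂ | ζ ^ L = 1},
        ¬ q x.2 = ζ * p x.1 :=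
      (eventually_all_finite hfin).2 fun ζ hζ => hcon ζ hζ
    refine hpq (hall.mono fun x hx (heq : p x.1 ^ L = q x.2 ^ L) => ?_)
    by_cases h0 : p x.1 = 0
    · rw [h0, zero_pow hL] at heq
      exact hx 1 (by simp) (by rw [h0, eq_zero_of_pow_eq_zero heq.symm, mul_zero])
    · refine hx (q x.2 / p x.1) ?_ (div_mul_cancel₀ _ h0).symm
      rw [mem_ofPred_eq, div_pow, ← heq, div_self (pow_ne_zero _ h0)]
  have hζ0 : ζ ≠ 0 := by
    rintro rfl
    simp [zero_pow hL] at hζL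
  set r := hq.hasStrictDerivAt.localInverse _ _ _ hq'
  have hra : AnalyticAt ℂ r 0 := by simpa [hq0] using hq.analyticAt_localInverse hq'
  have hrl : ∀ᶠ z in 𝓝 0, r (q z) = z := HasStrictDerivAt.eventually_left_inverse ..
  have hrr : ∀ᶠ w in 𝓝 0, q (r w) = w := by
    simpa [hq0] using
      HasStrictDerivAt.eventually_right_inverse (hf := hq.hasStrictDerivAt) (hf' := hq')
  have hr0 : r 0 = 0 := by simpa [hq0] using hrl.self_of_nhds
  have hr' : HasDerivAt r (deriv q 0)⁻¹ 0 := by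
    simpa [hq0] using (hq.hasStrictDerivAt.to_localInverse hq').hasDerivAt
  have hζp : AnalyticAt ℂ (fun z => ζ * p z) 0 := analyticAt_const.mul hp
  have hζp0 : ζ * p 0 = 0 := by rw [hp0, mul_zero]
  set h : ℂ → ℂ := fun z => r (ζ * p z) with hh
  have hha : AnalyticAt ℂ h 0 := AnalyticAt.fun_comp (by rwa [hζp0]) hζp
  have hh0 : h 0 = 0 := by simp [hh, hp0, hr0]
  obtain ⟨c, hc0, hc⟩ : ∃ c : ℂ, c ≠ 0 ∧ HasDerivAt h c 0 :=
    ⟨(deriv q 0)⁻¹ * (ζ * deriv p 0), mul_ne_zero (inv_ne_zero hq') (mul_ne_zero hζ0 hp'),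
      HasDerivAt.comp (h₂ := r) (h := fun z => ζ * p z) 0 (by rwa [hζp0])
        (hp.differentiableAt.hasDerivAt.const_mul ζ)⟩
  have hqh : ∀ᶠ z in 𝓝 0, p z ^ L = q (h z) ^ L := by
    have ht : Tendsto (fun z => ζ * p z) (𝓝 0) (𝓝 0) := by
      simpa [hp0] using hζp.continuousAt.tendsto
    filter_upwards [ht.eventually hrr] with z hz
    rw [hh, hz, mul_pow, hζL, one_mul]
  have hreal : ∃ᶠ s : ℝ in 𝓝[>] 0, ∃ t : ℝ, 0 < t ∧ h s = t := by
    have hpos : ∀ᶠ x : ℝ × ℝ in 𝓝[>] 0 ×ˢ 𝓝[>] 0, 0 < x.2 :=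
      tendsto_snd.eventually self_mem_nhdsWithin
    have := (hζ.and_eventually ((hsnd.eventually hrl).and hpos)).mono
      (q := fun x : ℝ × ℝ => ∃ t : ℝ, 0 < t ∧ h x.1 = t) fun x ⟨h1, h2, h3⟩ =>
        ⟨x.2, h3, by simp only [hh, ← h1, h2]⟩
    exact tendsto_fst.frequently this
  have hhR : AnalyticAt ℝ (fun s : ℝ => h s) 0 :=
    AnalyticAt.fun_comp (g := h) (f := fun s : ℝ => (s : ℂ))
      (by simpa using hha.restrictScalars (𝕜 := ℝ)) (Complex.ofRealCLM.analyticAt 0)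
  have him : AnalyticAt ℝ (fun s : ℝ => (h s).im) 0 := (Complex.imCLM.analyticAt _).fun_comp hhR
  have him0 : ∀ᶠ s : ℝ in 𝓝 0, (h s).im = 0 := by
    refine him.frequently_zero_iff_eventually_zero.1 ?_
    refine (hreal.mono ?_).filter_mono (nhdsWithin_mono 0 fun s hs => ne_of_gt hs)
    rintro s ⟨t, -, ht⟩
    simp [ht]
  have hre : ∀ᶠ s : ℝ in 𝓝 0, h s = ((h s).re : ℂ) :=
    him0.mono fun s hs => Complex.ext (by simp) (by simp [hs])
  have hc' : HasDerivAt h c ((0 : ℝ) : ℂ) := by simpa using hc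
  have hH' : HasDerivAt (fun s : ℝ => (h s).re) c.re 0 := hc'.real_of_complex
  have hcre : c = (c.re : ℂ) :=
    hc'.comp_ofReal.unique (hH'.ofReal_comp.congr_of_eventuallyEq hre)
  refine ⟨fun s => (h s).re, (Complex.reCLM.analyticAt _).fun_comp hhR, by simp [hh0], ?_, ?_⟩
  · rw [hH'.deriv]
    have hne : c.re ≠ 0 := fun h0 => hc0 (by rw [hcre, h0, Complex.ofReal_zero])
    refine lt_of_le_of_ne (not_lt.1 fun hneg => ?_) hne.symm
    have hslope := (hasDerivAt_iff_tendsto_slope.1 hH').eventually (Iio_mem_nhds hneg)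
    have hslope' := hslope.filter_mono (nhdsWithin_mono 0 fun s (hs : 0 < s) => ne_of_gt hs)
    obtain ⟨s, ⟨t, ht, hst⟩, hs, hs0⟩ :=
      (hreal.and_eventually (hslope'.and self_mem_nhdsWithin)).exists
    have hs0 : 0 < s := hs0
    simp [slope_def_field, hh0, hst] at hs
    exact absurd hs (not_lt.2 (by positivity))
  · have ht : Tendsto (fun s : ℝ => (s : ℂ)) (𝓝 0) (𝓝 0) := by
      simpa using Complex.continuous_ofReal.tendsto 0
    filter_upwards [ht.eventually hqh, hre] with s h1 h2
    rw [h1, ← h2]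

/-- If `F` and `G` agree along pairs of positive reals tending to `0`, then the two curves have a
common real parametrization, for all exponents which equalize the orders of vanishing. -/
theorem exists_common_parametrization {F G : ℂ → ℂ} (hF : AnalyticAt ℂ F 0)
    (hG : AnalyticAt ℂ G 0) (hFnc : ¬ ∀ᶠ z in 𝓝 0, F z = F 0) (hGnc : ¬ ∀ᶠ z in 𝓝 0, G z = G 0)
    (hFG : ∃ᶠ x : ℝ × ℝ in 𝓝[>] 0 ×ˢ 𝓝[>] 0, F x.1 = G x.2) {n m : ℕ} (hn : n ≠ 0) (hm : m ≠ 0)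
    (hnm : analyticOrderNatAt (fun z => F z - F 0) 0 * n =
      analyticOrderNatAt (fun z => G z - G 0) 0 * m) :
    ∃ H : ℝ → ℝ, AnalyticAt ℝ H 0 ∧ H 0 = 0 ∧
      0 < deriv H 0 ∧ ∀ᶠ s : ℝ in 𝓝 0, F ((s ^ n : ℝ) : ℂ) = G ((H s ^ m : ℝ) : ℂ) := by
  have hof : Tendsto (fun s : ℝ => (s : ℂ)) (𝓝 0) (𝓝 0) := by
    simpa using Complex.continuous_ofReal.tendsto 0
  have hof' := hof.mono_left (nhdsWithin_le_nhds (s := Ioi 0))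
  have h00 : F 0 = G 0 := by
    by_contra hne
    have h1 : Tendsto (fun x : ℝ × ℝ => F x.1) (𝓝[>] 0 ×ˢ 𝓝[>] 0) (𝓝 (F 0)) :=
      hF.continuousAt.tendsto.comp (hof'.comp tendsto_fst)
    have h2 : Tendsto (fun x : ℝ × ℝ => G x.2) (𝓝[>] 0 ×ˢ 𝓝[>] 0) (𝓝 (G 0)) :=
      hG.continuousAt.tendsto.comp (hof'.comp tendsto_snd)
    exact hFG (((h1.sub h2).eventually_ne (sub_ne_zero.2 hne)).mono fun _ => sub_ne_zero.1)
  obtain ⟨p, hp, hp0, hp', hFp⟩ := hF.exists_coordinate_pow_comp_pow hFnc hn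
  obtain ⟨q, hq, hq0, hq', hGq⟩ := hG.exists_coordinate_pow_comp_pow hGnc hm
  rw [← hnm] at hGq
  have hM := analyticOrderNatAt_sub_ne_zero hF hFnc
  set M := analyticOrderNatAt (fun z => F z - F 0) 0
  have hroot : ∀ k : ℕ, k ≠ 0 → Tendsto (fun u : ℝ => u ^ (k : ℝ)⁻¹) (𝓝[>] 0) (𝓝[>] 0) := by
    intro k hk
    refine tendsto_nhdsWithin_iff.2 ⟨?_, ?_⟩
    · have hk0 : (0 : ℝ) < (k : ℝ)⁻¹ := by positivity
      have := (Real.continuousAt_rpow_const 0 (k : ℝ)⁻¹ (Or.inr hk0.le)).tendsto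
      rw [Real.zero_rpow hk0.ne'] at this
      exact this.mono_left nhdsWithin_le_nhds
    · filter_upwards [self_mem_nhdsWithin] with u hu
      exact Real.rpow_pos_of_pos hu _
  have hFG' : ∃ᶠ x : ℝ × ℝ in 𝓝[>] 0 ×ˢ 𝓝[>] 0, F ((x.1 : ℂ) ^ n) = G ((x.2 : ℂ) ^ m) := by
    refine ((hroot n hn).prodMap (hroot m hm)).frequently ?_
    have hpos : ∀ᶠ x : ℝ × ℝ in 𝓝[>] 0 ×ˢ 𝓝[>] 0, 0 < x.1 ∧ 0 < x.2 :=
      (tendsto_fst.eventually self_mem_nhdsWithin).and (tendsto_snd.eventually self_mem_nhdsWithin)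
    refine (hFG.and_eventually hpos).mono ?_
    rintro ⟨u, v⟩ ⟨huv, hu, hv⟩
    simp only [Prod.map_apply, ← Complex.ofReal_pow]
    rwa [Real.rpow_inv_natCast_pow hu.le hn, Real.rpow_inv_natCast_pow hv.le hm]
  have hpq : ∃ᶠ x : ℝ × ℝ in 𝓝[>] 0 ×ˢ 𝓝[>] 0, p x.1 ^ (M * n) = q x.2 ^ (M * n) := by
    refine (hFG'.and_eventually (((hof'.comp tendsto_fst).eventually hFp).and
      ((hof'.comp tendsto_snd).eventually hGq))).mono ?_
    rintro x ⟨h1, h2, h3⟩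
    simp only [Function.comp_apply] at h2 h3
    rw [← h2, ← h3, h1, h00]
  obtain ⟨H, hH, hH0, hH', hpH⟩ :=
    exists_real_change_of_coordinates hp hq hp0 hq0 hp' hq' (mul_ne_zero hM hn) hpq
  refine ⟨H, hH, hH0, hH', ?_⟩
  have hHof : Tendsto (fun s : ℝ => (H s : ℂ)) (𝓝 0) (𝓝 0) :=
    hof.comp (by simpa [hH0] using hH.continuousAt.tendsto)
  filter_upwards [hpH, hof.eventually hFp, hHof.eventually hGq] with s h1 h2 h3
  rw [← h2, ← h3, h00] at h1
  simpa using sub_left_injective h1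

theorem StrictMonoOn.image_Ioo_of_continuousOn {f : ℝ → ℝ} {a b : ℝ} (hab : a ≤ b)
    (hf : StrictMonoOn f (Icc a b)) (hc : ContinuousOn f (Icc a b)) :
    f '' Ioo a b = Ioo (f a) (f b) := by
  refine Subset.antisymm ?_ (intermediate_value_Ioo hab hc)
  rintro _ ⟨x, hx, rfl⟩
  exact ⟨hf (left_mem_Icc.2 hab) (Ioo_subset_Icc_self hx) hx.1,
    hf (Ioo_subset_Icc_self hx) (right_mem_Icc.2 hab) hx.2⟩

theorem StrictMonoOn.image_Ico_of_continuousOn {f : ℝ → ℝ} {a b : ℝ} (hab : a ≤ b)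
    (hf : StrictMonoOn f (Icc a b)) (hc : ContinuousOn f (Icc a b)) :
    f '' Ico a b = Ico (f a) (f b) := by
  refine Subset.antisymm ?_ (intermediate_value_Ico hab hc)
  rintro _ ⟨x, hx, rfl⟩
  exact ⟨hf.monotoneOn (left_mem_Icc.2 hab) (Ico_subset_Icc_self hx) hx.1,
    hf (Ico_subset_Icc_self hx) (right_mem_Icc.2 hab) hx.2⟩

theorem StrictMonoOn.image_Ioc_of_continuousOn {f : ℝ → ℝ} {a b : ℝ} (hab : a ≤ b)
    (hf : StrictMonoOn f (Icc a b)) (hc : ContinuousOn f (Icc a b)) :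
    f '' Ioc a b = Ioc (f a) (f b) := by
  refine Subset.antisymm ?_ (intermediate_value_Ioc hab hc)
  rintro _ ⟨x, hx, rfl⟩
  exact ⟨hf (left_mem_Icc.2 hab) (Ioc_subset_Icc_self hx) hx.1,
    hf.monotoneOn (Ioc_subset_Icc_self hx) (right_mem_Icc.2 hab) hx.2⟩

/-- A real analytic germ with positive derivative is a continuous increasing function on all
sufficiently short intervals `[-δ, δ]`. -/
theorem AnalyticAt.exists_strictMonoOn_of_deriv_pos {H : ℝ → ℝ} (hH : AnalyticAt ℝ H 0)
    (hH' : 0 < deriv H 0) {P : ℝ → Prop} (hP : ∀ᶠ s in 𝓝 0, P s) :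
    ∃ δ > 0, StrictMonoOn H (Icc (-δ) δ) ∧ ContinuousOn H (Icc (-δ) δ) ∧
      ∀ s ∈ Icc (-δ) δ, P s := by
  have hev := (hH.eventually_analyticAt.and
    (hH.deriv.continuousAt.eventually (lt_mem_nhds hH'))).and hP
  obtain ⟨η, hη, hball⟩ := Metric.eventually_nhds_iff_ball.1 hev
  have hmem : ∀ s ∈ Icc (-(η / 2)) (η / 2), s ∈ ball (0 : ℝ) η := fun s hs => by
    rw [mem_ball_zero_iff, Real.norm_eq_abs, abs_lt]
    constructor <;> linarith [hs.1, hs.2]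
  have hcont : ContinuousOn H (Icc (-(η / 2)) (η / 2)) := fun s hs =>
    (hball s (hmem s hs)).1.1.continuousAt.continuousWithinAt
  refine ⟨η / 2, half_pos hη, ?_, hcont, fun s hs => (hball s (hmem s hs)).2⟩
  exact strictMonoOn_of_deriv_pos (convex_Icc _ _) hcont fun s hs =>
    (hball s (hmem s (interior_subset hs))).1.2

theorem tendsto_sub_comp_neg {f : ℝ → ℝ} (hf : ContinuousAt f 0) :
    Tendsto (fun s => f s - f (-s)) (𝓝 0) (𝓝 0) := by
  have hneg : Tendsto (fun s : ℝ => -s) (𝓝 0) (𝓝 0) := by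
    simpa using (continuous_neg (G := ℝ)).tendsto 0
  simpa using hf.tendsto.sub (hf.tendsto.comp hneg)

theorem bouncesBackAtZero_of_even {F G : ℂ → ℂ} {n m : ℕ} {H : ℝ → ℝ} (hn : Even n) (hm : Odd m)
    (hH : AnalyticAt ℝ H 0) (hH0 : H 0 = 0) (hH' : 0 < deriv H 0)
    (hFG : ∀ᶠ s : ℝ in 𝓝 0, F ((s ^ n : ℝ) : ℂ) = G ((H s ^ m : ℝ) : ℂ)) :
    BouncesBackAtZero G := by
  intro ε hε
  have hlen := (tendsto_sub_comp_neg (f := fun s => H s ^ m) (hH.continuousAt.pow m)).eventually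
    (gt_mem_nhds hε)
  obtain ⟨δ, hδ, hmono, hcont, hP⟩ := hH.exists_strictMonoOn_of_deriv_pos hH' (hFG.and hlen)
  have hBmono : StrictMonoOn (fun s => H s ^ m) (Icc (-δ) δ) :=
    hm.strictMono_pow.comp_strictMonoOn hmono
  have hBcont : ContinuousOn (fun s => H s ^ m) (Icc (-δ) δ) := hcont.pow m
  have hB0 : H 0 ^ m = 0 := by rw [hH0, zero_pow hm.pos.ne']
  have h0 : (0 : ℝ) ∈ Icc (-δ) δ := ⟨by linarith, hδ.le⟩
  have hl : (-δ) ∈ Icc (-δ) δ := ⟨le_rfl, by linarith⟩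
  have hr : δ ∈ Icc (-δ) δ := ⟨by linarith, le_rfl⟩
  have hright : (fun s => H s ^ m) '' Ico 0 δ = Ico 0 (H δ ^ m) := by
    simpa only [hB0] using (hBmono.mono (Icc_subset_Icc_left h0.1)).image_Ico_of_continuousOn hδ.le
      (hBcont.mono (Icc_subset_Icc_left h0.1))
  have hleft : (fun s => H s ^ m) '' Ioc (-δ) 0 = Ioc (H (-δ) ^ m) 0 := by
    simpa only [hB0] using (hBmono.mono (Icc_subset_Icc_right h0.2)).image_Ioc_of_continuousOn h0.1
      (hBcont.mono (Icc_subset_Icc_right h0.2))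
  have hsymm : ∀ s ∈ Icc (-δ) δ, G ((H (-s) ^ m : ℝ) : ℂ) = G ((H s ^ m : ℝ) : ℂ) := fun s hs => by
    rw [← (hP s hs).1, ← (hP (-s) ⟨by linarith [hs.2], by linarith [hs.1]⟩).1, hn.neg_pow]
  refine ⟨H (-δ) ^ m, H δ ^ m, ?_, ?_, (hP δ hr).2, ?_⟩
  · simpa only [hB0] using hBmono hl h0 (by linarith)
  · simpa only [hB0] using hBmono h0 hr hδ
  rw [← hright, ← hleft, image_image, image_image]
  apply Subset.antisymm
  · rintro _ ⟨s, hs, rfl⟩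
    exact ⟨-s, ⟨by linarith [hs.2], by linarith [hs.1]⟩, hsymm s ⟨by linarith [hs.1], hs.2.le⟩⟩
  · rintro _ ⟨s, hs, rfl⟩
    exact ⟨-s, ⟨by linarith [hs.2], by linarith [hs.1]⟩, hsymm s ⟨hs.1.le, by linarith [hs.2]⟩⟩

theorem shareCurveAtZero_of_odd {F G : ℂ → ℂ} {n m : ℕ} {H : ℝ → ℝ} (hn : Odd n) (hm : Odd m)
    (hH : AnalyticAt ℝ H 0) (hH0 : H 0 = 0) (hH' : 0 < deriv H 0)
    (hFG : ∀ᶠ s : ℝ in 𝓝 0, F ((s ^ n : ℝ) : ℂ) = G ((H s ^ m : ℝ) : ℂ)) :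
    ShareCurveAtZero F G := by
  intro ε hε
  have hlenA := (tendsto_sub_comp_neg (f := (· ^ n)) (continuous_pow n).continuousAt).eventually
    (gt_mem_nhds hε)
  have hlenB := (tendsto_sub_comp_neg (f := fun s => H s ^ m) (hH.continuousAt.pow m)).eventually
    (gt_mem_nhds hε)
  obtain ⟨δ, hδ, hmono, hcont, hP⟩ :=
    hH.exists_strictMonoOn_of_deriv_pos hH' (hFG.and (hlenA.and hlenB))
  have hA : StrictMono (fun s : ℝ => s ^ n) := hn.strictMono_pow
  have hBmono : StrictMonoOn (fun s => H s ^ m) (Icc (-δ) δ) :=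
    hm.strictMono_pow.comp_strictMonoOn hmono
  have hBcont : ContinuousOn (fun s => H s ^ m) (Icc (-δ) δ) := hcont.pow m
  have hA0 : (0 : ℝ) ^ n = 0 := zero_pow hn.pos.ne'
  have hB0 : H 0 ^ m = 0 := by rw [hH0, zero_pow hm.pos.ne']
  have h0 : (0 : ℝ) ∈ Icc (-δ) δ := ⟨by linarith, hδ.le⟩
  have hl : (-δ) ∈ Icc (-δ) δ := ⟨le_rfl, by linarith⟩
  have hr : δ ∈ Icc (-δ) δ := ⟨by linarith, le_rfl⟩
  refine ⟨(-δ) ^ n, δ ^ n, H (-δ) ^ m, H δ ^ m, ?_, ?_, (hP δ hr).2.1, ?_, ?_, (hP δ hr).2.2, ?_⟩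
  · simpa only [hA0] using hA (neg_lt_zero.2 hδ)
  · simpa only [hA0] using hA hδ
  · simpa only [hB0] using hBmono hl h0 (by linarith)
  · simpa only [hB0] using hBmono h0 hr hδ
  rw [← (hA.strictMonoOn (Icc (-δ) δ)).image_Ioo_of_continuousOn hl.2 (continuous_pow n).continuousOn,
    ← hBmono.image_Ioo_of_continuousOn hl.2 hBcont, image_image, image_image]
  exact image_congr fun s hs => (hP s (Ioo_subset_Icc_self hs)).1

theorem shareCurveAtZero_of_frequently_pos {F G : ℂ → ℂ} (hF : AnalyticAt ℂ F 0)
    (hG : AnalyticAt ℂ G 0) (hFnc : ¬ ∀ᶠ z in 𝓝 0, F z = F 0) (hGnc : ¬ ∀ᶠ z in 𝓝 0, G z = G 0)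
    (hFnb : ¬ BouncesBackAtZero F) (hGnb : ¬ BouncesBackAtZero G)
    (hFG : ∃ᶠ x : ℝ × ℝ in 𝓝[>] 0 ×ˢ 𝓝[>] 0, F x.1 = G x.2) : ShareCurveAtZero F G := by
  have hM := analyticOrderNatAt_sub_ne_zero hF hFnc
  have hN := analyticOrderNatAt_sub_ne_zero hG hGnc
  obtain ⟨m, n, hmn, hMm, hNn⟩ := Nat.exists_coprime
    (analyticOrderNatAt (fun z => F z - F 0) 0) (analyticOrderNatAt (fun z => G z - G 0) 0)
  have hm : m ≠ 0 := by
    rintro rfl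
    exact hM (by rw [hMm, zero_mul])
  have hn : n ≠ 0 := by
    rintro rfl
    exact hN (by rw [hNn, zero_mul])
  have hL : analyticOrderNatAt (fun z => F z - F 0) 0 * n =
      analyticOrderNatAt (fun z => G z - G 0) 0 * m := by
    generalize Nat.gcd _ _ = d at hMm hNn
    rw [hMm, hNn]
    ring
  obtain ⟨H, hH, hH0, hH', hFH⟩ := exists_common_parametrization hF hG hFnc hGnc hFG hn hm hL
  rcases Nat.even_or_odd n with hne | hno <;> rcases Nat.even_or_odd m with hme | hmo
  · exact absurd (hmn ▸ Nat.dvd_gcd hme.two_dvd hne.two_dvd) (by norm_num)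
  · exact absurd (bouncesBackAtZero_of_even hne hmo hH hH0 hH' hFH) hGnb
  · have hGF : ∃ᶠ x : ℝ × ℝ in 𝓝[>] 0 ×ˢ 𝓝[>] 0, G x.1 = F x.2 :=
      tendsto_prod_swap.frequently (hFG.mono fun x hx => hx.symm)
    obtain ⟨K, hK, hK0, hK', hGK⟩ :=
      exists_common_parametrization hG hF hGnc hFnc hGF hm hn hL.symm
    exact absurd (bouncesBackAtZero_of_even hme hno hK hK0 hK' hGK) hFnb
  · exact shareCurveAtZero_of_odd hno hmo hH hH0 hH' hFH

theorem ShareCurveAtZero.symm {F G : ℂ → ℂ} (h : ShareCurveAtZero F G) : ShareCurveAtZero G F := by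
  intro ε hε
  obtain ⟨a, b, c, d, ha, hb, hab, hc, hd, hcd, heq⟩ := h ε hε
  exact ⟨c, d, a, b, hc, hd, hcd, ha, hb, hab, heq.symm⟩

theorem image_comp_neg (F : ℂ → ℂ) (s : Set ℝ) :
    (fun t : ℝ => F (-t)) '' s = (fun t : ℝ => F t) '' (Neg.neg '' s) := by
  rw [image_image]
  simp only [Complex.ofReal_neg]

theorem ShareCurveAtZero.of_comp_neg {F G : ℂ → ℂ} (h : ShareCurveAtZero (fun z => F (-z)) G) :
    ShareCurveAtZero F G := by
  intro ε hε
  obtain ⟨a, b, c, d, ha, hb, hab, hc, hd, hcd, heq⟩ := h ε hε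
  refine ⟨-b, -a, c, d, by linarith, by linarith, by linarith, hc, hd, hcd, ?_⟩
  rw [image_comp_neg] at heq
  simpa using heq

theorem BouncesBackAtZero.of_comp_neg {F : ℂ → ℂ} (h : BouncesBackAtZero (fun z => F (-z))) :
    BouncesBackAtZero F := by
  intro ε hε
  obtain ⟨a, b, ha, hb, hab, heq⟩ := h ε hε
  refine ⟨-b, -a, by linarith, by linarith, by linarith, ?_⟩
  rw [image_comp_neg, image_comp_neg] at heq
  simpa using heq.symm

theorem AnalyticAt.fun_comp_neg_zero {F : ℂ → ℂ} (hF : AnalyticAt ℂ F 0) :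
    AnalyticAt ℂ (fun z => F (-z)) 0 :=
  AnalyticAt.fun_comp (by simpa using hF) analyticAt_id.neg

theorem not_eventually_const_comp_neg {F : ℂ → ℂ} (hF : ¬ ∀ᶠ z in 𝓝 0, F z = F 0) :
    ¬ ∀ᶠ z in 𝓝 0, F (-z) = F (-0) := fun h => hF <| by
  have ht : Tendsto (fun z : ℂ => -z) (𝓝 0) (𝓝 0) := by
    simpa using (continuous_neg (G := ℂ)).tendsto 0
  simpa using ht.eventually h

theorem tendsto_neg_nhdsLT_zero : Tendsto (fun s : ℝ => -s) (𝓝[<] 0) (𝓝[>] 0) := by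
  simpa using tendsto_neg_nhdsLT (a := (0 : ℝ))

theorem shareCurveAtZero_of_frequently_ne {F G : ℂ → ℂ} (hF : AnalyticAt ℂ F 0)
    (hG : AnalyticAt ℂ G 0) (hFnc : ¬ ∀ᶠ z in 𝓝 0, F z = F 0) (hGnc : ¬ ∀ᶠ z in 𝓝 0, G z = G 0)
    (hFnb : ¬ BouncesBackAtZero F) (hGnb : ¬ BouncesBackAtZero G)
    (hFG : ∃ᶠ x : ℝ × ℝ in 𝓝[≠] 0 ×ˢ 𝓝[≠] 0, F x.1 = G x.2) : ShareCurveAtZero F G := by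
  have hF' := hF.fun_comp_neg_zero
  have hG' := hG.fun_comp_neg_zero
  have hFnc' := not_eventually_const_comp_neg hFnc
  have hGnc' := not_eventually_const_comp_neg hGnc
  have hFnb' := mt BouncesBackAtZero.of_comp_neg hFnb
  have hGnb' := mt BouncesBackAtZero.of_comp_neg hGnb
  have hneg := tendsto_neg_nhdsLT_zero
  rw [← nhdsLT_sup_nhdsGT, prod_sup, sup_prod, sup_prod, frequently_sup, frequently_sup,
    frequently_sup] at hFG
  rcases hFG with (h | h) | (h | h)
  · refine (shareCurveAtZero_of_frequently_pos hF' hG' hFnc' hGnc' hFnb' hGnb'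
      ((hneg.prodMap hneg).frequently ?_)).of_comp_neg.symm.of_comp_neg.symm
    simpa using h
  · refine (shareCurveAtZero_of_frequently_pos hF hG' hFnc hGnc' hFnb hGnb'
      ((tendsto_id.prodMap hneg).frequently ?_)).symm.of_comp_neg.symm
    simpa using h
  · refine (shareCurveAtZero_of_frequently_pos hF' hG hFnc' hGnc hFnb' hGnb
      ((hneg.prodMap tendsto_id).frequently ?_)).of_comp_neg
    simpa using h
  · exact shareCurveAtZero_of_frequently_pos hF hG hFnc hGnc hFnb hGnb h

theorem ShareCurveAtZero.apply_zero_eq {F G : ℂ → ℂ} (hG : ContinuousAt G 0)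
    (h : ShareCurveAtZero F G) : F 0 = G 0 := by
  by_contra hne
  have hof : Tendsto (fun s : ℝ => G s) (𝓝 0) (𝓝 (G 0)) :=
    hG.tendsto.comp (by simpa using Complex.continuous_ofReal.tendsto 0)
  obtain ⟨δ, hδ, hball⟩ :=
    Metric.eventually_nhds_iff_ball.1 (hof.eventually_ne (Ne.symm hne))
  obtain ⟨a, b, c, d, ha, hb, -, hc, hd, hcd, heq⟩ := h δ hδ
  obtain ⟨v, hv, hv'⟩ := heq.subset ⟨0, ⟨ha, hb⟩, rfl⟩
  refine hball v ?_ (by simpa using hv')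
  rw [mem_ball_zero_iff, Real.norm_eq_abs, abs_lt]
  constructor <;> linarith [hv.1, hv.2]

theorem ShareCurveAtZero.exists_ne_zero {F G : ℂ → ℂ} (hF : AnalyticAt ℂ F 0)
    (hG : ContinuousAt G 0) (hFnc : ¬ ∀ᶠ z in 𝓝 0, F z = F 0) (h : ShareCurveAtZero F G) {ε : ℝ}
    (hε : 0 < ε) : ∃ u v : ℝ, u ≠ 0 ∧ v ≠ 0 ∧ |u| < ε ∧ |v| < ε ∧ F u = G v := by
  have hne : ∀ᶠ z in 𝓝[≠] 0, F z ≠ F 0 :=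
    (hF.eventually_eq_or_eventually_ne analyticAt_const).resolve_left hFnc
  obtain ⟨δ, hδ, hball⟩ := Metric.eventually_nhds_iff_ball.1 (eventually_nhdsWithin_iff.1 hne)
  obtain ⟨a, b, c, d, ha, hb, hab, hc, hd, hcd, heq⟩ := h (min ε δ) (lt_min hε hδ)
  obtain ⟨v, hv, hv'⟩ := heq.subset ⟨b / 2, ⟨by linarith, by linarith⟩, rfl⟩
  have hv'' : G v = F ((b / 2 : ℝ) : ℂ) := hv'
  have habs : |b / 2| < min ε δ := by
    rw [abs_of_pos (half_pos hb)]
    linarith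
  refine ⟨b / 2, v, (half_pos hb).ne', ?_, habs.trans_le (min_le_left _ _), ?_, hv''.symm⟩
  · rintro rfl
    refine hball ((b / 2 : ℝ) : ℂ) ?_ ?_ ?_
    · rw [mem_ball_zero_iff, Complex.norm_real, Real.norm_eq_abs]
      exact habs.trans_le (min_le_right _ _)
    · exact Complex.ofReal_ne_zero.2 (half_pos hb).ne'
    · rw [← hv'', Complex.ofReal_zero, h.apply_zero_eq hG]
  · refine lt_of_lt_of_le ?_ (min_le_left ε δ)
    rw [abs_lt]
    constructor <;> linarith [hv.1, hv.2]

theorem AnalyticOnNhd.not_eventually_const {F : ℂ → ℂ} {r : ℝ} (hr : 0 < r)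
    (hF : AnalyticOnNhd ℂ F (ball 0 r)) (hnc : ∃ z ∈ ball (0 : ℂ) r, F z ≠ F 0) :
    ¬ ∀ᶠ z in 𝓝 0, F z = F 0 := by
  obtain ⟨z, hz, hne⟩ := hnc
  exact fun h => hne (hF.eqOn_of_preconnected_of_eventuallyEq (fun _ _ => analyticAt_const)
    (convex_ball 0 r).isPreconnected (mem_ball_self hr) h hz)

theorem rough_agreement_iff_share_curve
    (F G : ℂ → ℂ) (r : ℝ) (hr : 0 < r)
    (hF : AnalyticOnNhd ℂ F (ball 0 r)) (hG : AnalyticOnNhd ℂ G (ball 0 r))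
    (hFnc : ∃ z ∈ ball (0:ℂ) r, F z ≠ F 0) (hGnc : ∃ z ∈ ball (0:ℂ) r, G z ≠ G 0)
    (hFnb : ¬ BouncesBackAtZero F) (hGnb : ¬ BouncesBackAtZero G) :
    (∃ u v : ℕ → ℝ, (∀ k, u k ≠ 0) ∧ (∀ k, v k ≠ 0) ∧
        Tendsto u atTop (nhds 0) ∧ Tendsto v atTop (nhds 0) ∧
        ∀ k, F (u k) = G (v k)) ↔
      ShareCurveAtZero F G := by
  have hF0 := hF 0 (mem_ball_self hr)
  have hG0 := hG 0 (mem_ball_self hr)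
  have hFnc' := hF.not_eventually_const hr hFnc
  have hGnc' := hG.not_eventually_const hr hGnc
  constructor
  · rintro ⟨u, v, hu, hv, hu0, hv0, huv⟩
    have hu' : Tendsto u atTop (𝓝[≠] 0) := tendsto_nhdsWithin_iff.2 ⟨hu0, .of_forall hu⟩
    have hv' : Tendsto v atTop (𝓝[≠] 0) := tendsto_nhdsWithin_iff.2 ⟨hv0, .of_forall hv⟩
    exact shareCurveAtZero_of_frequently_ne hF0 hG0 hFnc' hGnc' hFnb hGnb
      ((hu'.prodMk hv').frequently (Frequently.of_forall huv))
  · intro h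
    have hε : ∀ k : ℕ, (0 : ℝ) < 1 / ((k : ℝ) + 1) := fun k => Nat.one_div_pos_of_nat
    choose u v hu hv hu' hv' huv using fun k : ℕ =>
      h.exists_ne_zero hF0 hG0.continuousAt hFnc' (hε k)
    exact ⟨u, v, hu, hv,
      squeeze_zero_norm (fun k => (hu' k).le) tendsto_one_div_add_atTop_nhds_zero_nat,
      squeeze_zero_norm (fun k => (hv' k).le) tendsto_one_div_add_atTop_nhds_zero_nat, huv⟩
end

section
/- Let F be analytic in a complex neighborhood of ℝ and locally injective on ℝ. If there exist real numbers γ < δ such that (γ,δ) is a limit point of the set of self-intersections {(a,b) : a ≠ b, F(a)=F(b)} and no c ∈ (γ,δ) satisfies that (γ,c) is such a limit point, then F(ℝ) = F([γ,δ]) and F(γ) = F(δ); in particular F(ℝ) is a loop. -/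
open Set
open Filter Topology

/-- A local analytic coordinate `σ` at `a`, with analytic local inverse `inv`, in which the distance
of `f` to `f a` is a pure power. -/
structure NormCoordinate (f : ℝ → ℂ) (a : ℝ) where
  order : ℕ
  σ : ℝ → ℝ
  inv : ℝ → ℝ
  order_ne_zero : order ≠ 0
  analyticAt_σ : AnalyticAt ℝ σ a
  analyticAt_inv : AnalyticAt ℝ inv 0
  σ_self : σ a = 0
  inv_zero : inv 0 = a
  inv_σ : ∀ᶠ x in 𝓝 a, inv (σ x) = x
  σ_inv : ∀ᶠ y in 𝓝 0, σ (inv y) = y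
  norm_sub : ∀ᶠ x in 𝓝 a, ‖f x - f a‖ = |σ x| ^ order

theorem NormCoordinate.exists_of_analyticAt {f : ℝ → ℂ} {a : ℝ} (hf : AnalyticAt ℝ f a)
    (hne : ¬ ∀ᶠ x in 𝓝 a, f x = f a) : Nonempty (NormCoordinate f a) := by
  have hsub : AnalyticAt ℝ (fun x => f x - f a) a := hf.sub analyticAt_const
  obtain ⟨k, g, hg, hg0, hfg⟩ := hsub.exists_eventuallyEq_pow_smul_nonzero_iff.mpr (by
    simpa only [sub_eq_zero] using hne)
  have hk : k ≠ 0 := by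
    rintro rfl
    have := hfg.self_of_nhds
    simp at this
    exact hg0 this.symm
  have hsq : AnalyticAt ℝ (fun x => Complex.normSq (g x)) a := by
    have h1 : AnalyticAt ℝ (fun x => (g x).re) a := (Complex.reCLM.analyticAt _).comp hg
    have h2 : AnalyticAt ℝ (fun x => (g x).im) a := (Complex.imCLM.analyticAt _).comp hg
    simp only [Complex.normSq_apply]
    exact (h1.mul h1).add (h2.mul h2)
  have hpos : 0 < Complex.normSq (g a) := Complex.normSq_pos.mpr hg0
  set u : ℝ → ℝ := fun x => Real.exp (Real.log (Complex.normSq (g x)) / (2 * k)) with hu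
  have hua : AnalyticAt ℝ u a := by
    have hl : AnalyticAt ℝ (fun x => Real.log (Complex.normSq (g x))) a :=
      hsq.log hpos
    exact (hl.div_const).rexp
  have hupos : ∀ x, 0 < u x := fun x => Real.exp_pos _
  have huk : ∀ᶠ x in 𝓝 a, u x ^ k = ‖g x‖ := by
    filter_upwards [hg.continuousAt.eventually_ne hg0] with x hx
    have h2 : 0 < ‖g x‖ := norm_pos_iff.mpr hx
    have hk' : (k : ℝ) ≠ 0 := Nat.cast_ne_zero.mpr hk
    rw [hu, ← Real.exp_nat_mul, Complex.normSq_eq_norm_sq, Real.log_pow]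
    rw [show (k : ℝ) * (((2 : ℕ) : ℝ) * Real.log ‖g x‖ / (2 * k)) = Real.log ‖g x‖ by
      push_cast; field_simp]
    exact Real.exp_log h2
  set σ : ℝ → ℝ := fun x => (x - a) * u x with hσ
  have hσa : AnalyticAt ℝ σ a := (analyticAt_id.sub analyticAt_const).mul hua
  have hσ0 : σ a = 0 := by simp [hσ]
  have hder : deriv σ a = u a := by
    have h1 : HasDerivAt (fun x : ℝ => x - a) 1 a := (hasDerivAt_id a).sub_const a
    exact (h1.mul hua.differentiableAt.hasDerivAt).deriv.trans (by simp)
  have hder0 : deriv σ a ≠ 0 := by rw [hder]; exact (hupos a).ne'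
  have hinv := hσa.analyticAt_localInverse hder0
  have hl := hσa.hasStrictDerivAt.eventually_left_inverse hder0
  have hr := hσa.hasStrictDerivAt.eventually_right_inverse hder0
  have hl0 := hl.self_of_nhds
  rw [hσ0] at hinv hr hl0
  refine ⟨⟨k, σ, _, hk, hσa, hinv, hσ0, hl0, hl, hr, ?_⟩⟩
  filter_upwards [huk, hfg] with x h1 h2
  rw [h2, norm_smul, ← h1, hσ, abs_mul, mul_pow, abs_of_pos (hupos x), norm_pow, Real.norm_eq_abs]

/-- `h` is continuous near `a`, maps `a` to `b`, and satisfies `f ∘ h = f` near `a`. -/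
structure IsTransition (f : ℝ → ℂ) (h : ℝ → ℝ) (a b : ℝ) : Prop where
  map_self : h a = b
  continuousAt : ∀ᶠ x in 𝓝 a, ContinuousAt h x
  comp_eq : ∀ᶠ x in 𝓝 a, f (h x) = f x

theorem exists_continuous_odd_root {m : ℕ} (hm : Odd m) :
    ∃ ρ : ℝ → ℝ, Continuous ρ ∧ ρ 0 = 0 ∧ ∀ x, ρ x ^ m = x := by
  have hmono : StrictMono fun x : ℝ => x ^ m := hm.strictMono_pow
  have hsurj : Function.Surjective fun x : ℝ => x ^ m :=
    (continuous_pow m).surjective (tendsto_pow_atTop hm.pos.ne')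
      (tendsto_neg_atTop_iff.mp (by
        have := (tendsto_pow_atTop (α := ℝ) hm.pos.ne').comp tendsto_neg_atBot_atTop
        refine this.congr fun x => ?_
        simp [hm.neg_pow]))
  let e := hmono.orderIsoOfSurjective _ hsurj
  have he : ∀ x, e.symm x ^ m = x := fun x => e.apply_symm_apply x
  refine ⟨e.symm, e.symm.continuous, ?_, he⟩
  exact pow_eq_zero_iff hm.pos.ne' |>.mp (he 0)

variable {f : ℝ → ℂ} {a b : ℝ}

theorem NormCoordinate.tendsto_inv_pow (c : NormCoordinate f a) (ε : ℝ) {m : ℕ} (hm : m ≠ 0) :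
    Tendsto (fun r : ℝ => c.inv (ε * r ^ m)) (𝓝 0) (𝓝 a) := by
  have h1 : Tendsto (fun r : ℝ => ε * r ^ m) (𝓝 0) (𝓝 0) := by
    have : Continuous fun r : ℝ => ε * r ^ m := by fun_prop
    simpa [hm] using this.tendsto 0
  have h2 := c.analyticAt_inv.continuousAt.tendsto
  rw [c.inv_zero] at h2
  exact h2.comp h1

theorem NormCoordinate.odd_of_eventually_eq (ca : NormCoordinate f a) (cb : NormCoordinate f b)
    (hinj : ∃ s ∈ 𝓝 b, InjOn f s) {ε η : ℝ} (hη : η ≠ 0) {m k : ℕ} (hk : k ≠ 0)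
    (hmk : m.Coprime k)
    (h : ∀ᶠ r in 𝓝 (0 : ℝ), f (ca.inv (ε * r ^ m)) = f (cb.inv (η * r ^ k))) : Odd m := by
  by_contra hm
  rw [Nat.not_odd_iff_even] at hm
  have hkodd : Odd k := by
    by_contra hk'
    rw [Nat.not_odd_iff_even] at hk'
    have := Nat.dvd_gcd hm.two_dvd hk'.two_dvd
    rw [hmk] at this
    omega
  obtain ⟨s, hs, hinj⟩ := hinj
  have hT := cb.tendsto_inv_pow η hk
  have hcont : Tendsto (fun r : ℝ => η * r ^ k) (𝓝 0) (𝓝 0) := by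
    have : Continuous fun r : ℝ => η * r ^ k := by fun_prop
    simpa [hk] using this.tendsto 0
  have hneg : Tendsto (fun r : ℝ => -r) (𝓝 0) (𝓝 0) := by
    simpa using (continuous_neg (G := ℝ)).tendsto 0
  have hall := (h.and (hT.eventually_mem hs)).and (hcont.eventually cb.σ_inv)
  have hev : ∀ᶠ r in 𝓝 (0 : ℝ), r = 0 := by
    filter_upwards [hall, hneg.eventually hall] with r ⟨⟨h1, h2⟩, h3⟩ ⟨⟨h4, h5⟩, h6⟩
    rw [hm.neg_pow, h1] at h4
    have h7 := hinj h2 h5 h4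
    rw [← h7, h3, hkodd.neg_pow] at h6
    have h8 : η * r ^ k = 0 := by linarith
    simpa [hη, hk] using h8
  obtain ⟨r, hr, hr0⟩ :=
    ((hev.filter_mono nhdsWithin_le_nhds).and (self_mem_nhdsWithin (a := (0 : ℝ)) (s := {0}ᶜ))).exists
  exact hr0 hr

theorem NormCoordinate.exists_isTransition (ca : NormCoordinate f a) (cb : NormCoordinate f b)
    (hb : ∃ s ∈ 𝓝 b, InjOn f s) (hfa : AnalyticAt ℝ f a) (hfb : AnalyticAt ℝ f b)
    {ε η : ℝ} (hε : ε ≠ 0) (hη : η ≠ 0) {m k : ℕ} (hm : m ≠ 0) (hk : k ≠ 0) (hmk : m.Coprime k)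
    (h : ∃ᶠ r in 𝓝[≠] (0 : ℝ), f (ca.inv (ε * r ^ m)) = f (cb.inv (η * r ^ k))) :
    ∃ h, IsTransition f h a b := by
  have key : ∀ {x : ℝ} (c : NormCoordinate f x) (ε : ℝ) {m : ℕ}, m ≠ 0 → AnalyticAt ℝ f x →
      AnalyticAt ℝ (fun r => f (c.inv (ε * r ^ m))) 0 := by
    intro x c ε m hm hf
    have h1 : AnalyticAt ℝ (fun r : ℝ => ε * r ^ m) 0 :=
      analyticAt_const.mul (analyticAt_id.pow m)
    have h2 : AnalyticAt ℝ (fun r : ℝ => c.inv (ε * r ^ m)) 0 :=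
      AnalyticAt.fun_comp (f := fun r : ℝ => ε * r ^ m) (by simpa [hm] using c.analyticAt_inv) h1
    exact AnalyticAt.fun_comp (f := fun r : ℝ => c.inv (ε * r ^ m))
      (by simpa [hm, c.inv_zero] using hf) h2
  have hev := ((key ca ε hm hfa).frequently_eq_iff_eventually_eq (key cb η hk hfb)).mp h
  have hmodd := ca.odd_of_eventually_eq cb hb hη hk hmk hev
  obtain ⟨ρ, hρ, hρ0, hρm⟩ := exists_continuous_odd_root hmodd
  have hσ := ca.analyticAt_σ.continuousAt
  have hθ0 : ρ (ε⁻¹ * ca.σ a) = 0 := by rw [ca.σ_self, mul_zero, hρ0]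
  have hθ : Tendsto (fun x => ρ (ε⁻¹ * ca.σ x)) (𝓝 a) (𝓝 0) := by
    have : ContinuousAt (fun x => ρ (ε⁻¹ * ca.σ x)) a :=
      hρ.continuousAt.comp (continuousAt_const.mul hσ)
    simpa only [ContinuousAt, hθ0] using this
  have hpow : Tendsto (fun r : ℝ => η * r ^ k) (𝓝 0) (𝓝 0) := by
    have : Continuous fun r : ℝ => η * r ^ k := by fun_prop
    simpa [hk] using this.tendsto 0
  refine ⟨fun x => cb.inv (η * ρ (ε⁻¹ * ca.σ x) ^ k), ?_, ?_, ?_⟩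
  · simp only [hθ0]
    rw [zero_pow hk, mul_zero, cb.inv_zero]
  · filter_upwards [ca.analyticAt_σ.eventually_analyticAt,
      (hpow.comp hθ).eventually cb.analyticAt_inv.eventually_analyticAt] with x h1 h2
    have h3 : ContinuousAt (fun x => η * ρ (ε⁻¹ * ca.σ x) ^ k) x :=
      continuousAt_const.mul ((hρ.continuousAt.comp (continuousAt_const.mul h1.continuousAt)).pow k)
    exact ContinuousAt.comp (f := fun x => η * ρ (ε⁻¹ * ca.σ x) ^ k) h2.continuousAt h3
  · filter_upwards [hθ.eventually hev, ca.inv_σ] with x h1 h2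
    rw [← h1, hρm, mul_inv_cancel_left₀ hε, h2]

theorem NormCoordinate.exists_isTransition_of_frequently_eq
    (ca : NormCoordinate f a) (cb : NormCoordinate f b)
    (hb : ∃ s ∈ 𝓝 b, InjOn f s) (hfa : AnalyticAt ℝ f a) (hfb : AnalyticAt ℝ f b) (hab : f a = f b)
    (h : ∃ᶠ p in 𝓝[≠] (a, b), f p.1 = f p.2) :
    ∃ h, IsTransition f h a b := by
  obtain ⟨sb, hsb, hib⟩ := hb
  obtain ⟨m, k, hmk, hm, hk⟩ := Nat.exists_coprime ca.order cb.order
  set d := Nat.gcd ca.order cb.order with hd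
  have hd0 : d ≠ 0 := Nat.gcd_ne_zero_left ca.order_ne_zero
  have hm0 : m ≠ 0 := by rintro rfl; exact ca.order_ne_zero (by simpa using hm)
  have hk0 : k ≠ 0 := by rintro rfl; exact cb.order_ne_zero (by simpa using hk)
  have hle : 𝓝[≠] (a, b) ≤ 𝓝 a ×ˢ 𝓝 b := nhdsWithin_le_nhds.trans_eq nhds_prod_eq
  have t1 : Tendsto Prod.fst (𝓝[≠] (a, b)) (𝓝 a) := tendsto_fst.mono_left hle
  have t2 : Tendsto Prod.snd (𝓝[≠] (a, b)) (𝓝 b) := tendsto_snd.mono_left hle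
  -- the common radius of the two coordinates
  set r : ℝ × ℝ → ℝ := fun p => |ca.σ p.1| ^ ((k : ℝ)⁻¹) with hr
  have hr0 : Tendsto r (𝓝[≠] (a, b)) (𝓝 0) := by
    have h1 : ContinuousAt (fun x => |ca.σ x| ^ ((k : ℝ)⁻¹)) a :=
      (ca.analyticAt_σ.continuousAt.abs).rpow_const (Or.inr (by positivity))
    have h2 : |ca.σ a| ^ ((k : ℝ)⁻¹) = 0 := by
      rw [ca.σ_self, abs_zero, Real.zero_rpow (by positivity)]
    have h3 := h1.tendsto
    rw [h2] at h3
    exact h3.comp t1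
  have hex : ∃ ε ∈ ({1, -1} : Set ℝ), ∃ η ∈ ({1, -1} : Set ℝ),
      ∃ᶠ r in 𝓝[≠] (0 : ℝ), f (ca.inv (ε * r ^ k)) = f (cb.inv (η * r ^ m)) := by
    by_contra hcon
    push Not at hcon
    have hfin : ∀ᶠ r in 𝓝[≠] (0 : ℝ), ∀ ε ∈ ({1, -1} : Set ℝ), ∀ η ∈ ({1, -1} : Set ℝ),
        f (ca.inv (ε * r ^ k)) ≠ f (cb.inv (η * r ^ m)) := by
      have hf2 : ({1, -1} : Set ℝ).Finite := by simp
      rw [eventually_all_finite hf2]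
      intro ε hε
      rw [eventually_all_finite hf2]
      intro η hη
      exact hcon ε hε η hη
    rw [eventually_nhdsWithin_iff] at hfin
    refine h ?_
    filter_upwards [hr0.eventually hfin, self_mem_nhdsWithin, t2.eventually_mem hsb, t1.eventually ca.norm_sub, t2.eventually cb.norm_sub,
      t1.eventually ca.inv_σ, t2.eventually cb.inv_σ] with p hp hpne hp2 hn1 hn2 hi1 hi2 heq
    have hx : p.1 ≠ a := by
      intro hx
      apply hpne
      rw [hx, hab] at heq
      exact Prod.ext hx (hib hp2 (mem_of_mem_nhds hsb) heq.symm)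
    have hσ : ca.σ p.1 ≠ 0 := fun h0 => hx (by rw [← hi1, h0, ca.inv_zero])
    have hrpos : 0 < r p := Real.rpow_pos_of_pos (abs_pos.mpr hσ) _
    have hrk : r p ^ k = |ca.σ p.1| := Real.rpow_inv_natCast_pow (abs_nonneg _) hk0
    have hrm : r p ^ m = |cb.σ p.2| := by
      have h1 : |ca.σ p.1| ^ ca.order = |cb.σ p.2| ^ cb.order := by
        rw [← hn1, ← hn2, heq, hab]
      rw [← hrk, hm, hk, ← pow_mul] at h1
      refine (pow_left_inj₀ (by positivity) (abs_nonneg _) (mul_ne_zero hk0 hd0)).mp ?_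
      rw [← h1]
      ring
    have sgn : ∀ x : ℝ, ∃ ε ∈ ({1, -1} : Set ℝ), ε * |x| = x := by
      intro x
      rcases le_total 0 x with h0 | h0
      · exact ⟨1, by simp, by simp [abs_of_nonneg h0]⟩
      · exact ⟨-1, by simp, by simp [abs_of_nonpos h0]⟩
    obtain ⟨ε, hε, he⟩ := sgn (ca.σ p.1)
    obtain ⟨η, hη, he'⟩ := sgn (cb.σ p.2)
    refine hp hrpos.ne' ε hε η hη ?_
    rw [hrk, hrm, he, he', hi1, hi2, heq]
  obtain ⟨ε, hε, η, hη, hfr⟩ := hex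
  have hne : ∀ ε ∈ ({1, -1} : Set ℝ), ε ≠ 0 := by
    rintro ε (rfl | rfl) <;> norm_num
  exact ca.exists_isTransition cb ⟨sb, hsb, hib⟩ hfa hfb (hne ε hε) (hne η hη) hk0 hm0
    hmk.symm hfr

theorem isTransition_id (f : ℝ → ℂ) (a : ℝ) : IsTransition f id a a :=
  ⟨rfl, Eventually.of_forall fun _ => continuousAt_id, Eventually.of_forall fun _ => rfl⟩

namespace IsTransition

variable {h g : ℝ → ℝ} {c : ℝ}

theorem tendsto (H : IsTransition f h a b) : Tendsto h (𝓝 a) (𝓝 b) := by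
  simpa only [ContinuousAt, H.map_self] using H.continuousAt.self_of_nhds

theorem eventually (H : IsTransition f h a b) : ∀ᶠ x in 𝓝 a, IsTransition f h x (h x) := by
  filter_upwards [H.continuousAt.eventually_nhds, H.comp_eq.eventually_nhds] with x h1 h2
  exact ⟨rfl, h1, h2⟩

theorem apply_eq (H : IsTransition f h a b) : f a = f b := by
  rw [← H.map_self, H.comp_eq.self_of_nhds]

theorem comp (G : IsTransition f g b c) (H : IsTransition f h a b) :
    IsTransition f (g ∘ h) a c := by
  refine ⟨by rw [Function.comp, H.map_self, G.map_self], ?_, ?_⟩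
  · filter_upwards [H.continuousAt, H.tendsto.eventually G.continuousAt] with x h1 h2
    exact ContinuousAt.comp h2 h1
  · filter_upwards [H.comp_eq, H.tendsto.eventually G.comp_eq] with x h1 h2
    exact h2.trans h1

theorem strictMonoOn_or_strictAntiOn (H : IsTransition f h a b) (ha : ∃ s ∈ 𝓝 a, InjOn f s) :
    ∃ s ∈ 𝓝 a, StrictMonoOn h s ∨ StrictAntiOn h s := by
  obtain ⟨s, hs, hinj⟩ := ha
  obtain ⟨r, hr, hsub⟩ := Metric.nhds_basis_closedBall.mem_iff.mp
    (inter_mem hs (H.continuousAt.and H.comp_eq))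
  refine ⟨_, Metric.closedBall_mem_nhds a hr, ?_⟩
  rw [Real.closedBall_eq_Icc] at hsub ⊢
  refine ContinuousOn.strictMonoOn_of_injOn_Icc' (by linarith)
    (fun x hx => (hsub hx).2.1.continuousWithinAt) fun x hx y hy hxy => ?_
  refine hinj (hsub hx).1 (hsub hy).1 ?_
  rw [← (hsub hx).2.2, ← (hsub hy).2.2, hxy]

end IsTransition

/-- Near a nontrivial limit of self-intersections, the two branches of `f` are reparametrizations
of each other. -/
theorem exists_isTransition_of_frequently_eq (hf : ∀ x, AnalyticAt ℝ f x)
    (hinj : ∀ x, ∃ s ∈ 𝓝 x, InjOn f s) (h : ∃ᶠ p in 𝓝[≠] (a, b), f p.1 = f p.2) :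
    ∃ h, IsTransition f h a b := by
  have hcont : Continuous f := continuous_iff_continuousAt.mpr fun x => (hf x).continuousAt
  have hab : f a = f b := by
    have hcl : IsClosed {p : ℝ × ℝ | f p.1 = f p.2} :=
      isClosed_eq (hcont.comp continuous_fst) (hcont.comp continuous_snd)
    exact hcl.closure_subset
      (mem_closure_iff_frequently.mpr (h.filter_mono nhdsWithin_le_nhds))
  have hne : ∀ x, ¬ ∀ᶠ y in 𝓝 x, f y = f x := by
    intro x hx
    obtain ⟨s, hs, hi⟩ := hinj x
    have hev : ∀ᶠ y in 𝓝 x, y = x := by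
      filter_upwards [hx, hs] with y h1 h2 using hi h2 (mem_of_mem_nhds hs) h1
    obtain ⟨y, hy, hy'⟩ :=
      ((hev.filter_mono nhdsWithin_le_nhds).and (self_mem_nhdsWithin (a := x) (s := {x}ᶜ))).exists
    exact hy' hy
  obtain ⟨ca⟩ := NormCoordinate.exists_of_analyticAt (hf a) (hne a)
  obtain ⟨cb⟩ := NormCoordinate.exists_of_analyticAt (hf b) (hne b)
  exact ca.exists_isTransition_of_frequently_eq cb (hinj b) (hf a) (hf b) hab h

theorem isClosed_setOf_isTransition (hf : ∀ x, AnalyticAt ℝ f x)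
    (hinj : ∀ x, ∃ s ∈ 𝓝 x, InjOn f s) :
    IsClosed {p : ℝ × ℝ | ∃ h, IsTransition f h p.1 p.2} := by
  refine isClosed_of_closure_subset fun p hp => ?_
  by_contra hcon
  refine hcon (exists_isTransition_of_frequently_eq hf hinj ?_)
  rw [frequently_nhdsWithin_iff]
  refine (mem_closure_iff_frequently.mp hp).mono fun q hq => ?_
  refine ⟨hq.choose_spec.apply_eq, ?_⟩
  rintro rfl
  exact hcon hq

theorem isClosed_setOf_isTransition_strictAntiOn (hf : ∀ x, AnalyticAt ℝ f x)
    (hinj : ∀ x, ∃ s ∈ 𝓝 x, InjOn f s) :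
    IsClosed {p : ℝ × ℝ | ∃ h, IsTransition f h p.1 p.2 ∧ ∃ s ∈ 𝓝 p.1, StrictAntiOn h s} := by
  refine isClosed_of_closure_subset ?_
  rintro ⟨a, b⟩ hp
  obtain ⟨h, H⟩ : ∃ h, IsTransition f h a b :=
    (isClosed_setOf_isTransition hf hinj).closure_subset
      (closure_mono (fun _ hq => hq.imp fun _ => And.left) hp)
  obtain ⟨s, hs, hmono | hanti⟩ := H.strictMonoOn_or_strictAntiOn (hinj a)
  swap
  · exact ⟨h, H, s, hs, hanti⟩
  exfalso
  obtain ⟨V, hV, hVinj⟩ := hinj b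
  have h1 : ∀ᶠ x in 𝓝 a, x ∈ s ∧ h x ∈ V ∧ f (h x) = f x :=
    (eventually_mem_set.mpr hs).and ((H.tendsto.eventually_mem hV).and H.comp_eq)
  have h2 : ∀ᶠ p in 𝓝 (a, b), (∀ᶠ x in 𝓝 p.1, x ∈ s ∧ h x ∈ V ∧ f (h x) = f x) ∧ V ∈ 𝓝 p.2 :=
    (continuous_fst.tendsto (a, b) |>.eventually h1.eventually_nhds).and
      (continuous_snd.tendsto (a, b) |>.eventually
        (eventually_eventually_nhds.mpr (eventually_mem_set.mpr hV)))
  obtain ⟨⟨x, z⟩, ⟨g, G, t, ht, hganti⟩, hx, hVz⟩ :=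
    ((mem_closure_iff_frequently.mp hp).and_eventually h2).exists
  have hgh : ∀ᶠ y in 𝓝 x, (y ∈ s ∧ y ∈ t) ∧ g y = h y := by
    filter_upwards [hx, ht, G.tendsto.eventually_mem hVz, G.comp_eq] with y ⟨h3, h4, h5⟩ h6 h7 h8
    exact ⟨⟨h3, h6⟩, hVinj h7 h4 (h8.trans h5.symm)⟩
  obtain ⟨⟨hxs, hxt⟩, hxe⟩ := hgh.self_of_nhds
  obtain ⟨y, ⟨⟨hys, hyt⟩, hye⟩, hxy⟩ := ((hgh.filter_mono nhdsWithin_le_nhds).and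
    (self_mem_nhdsWithin (a := x) (s := Ioi x))).exists
  have h9 := hmono hxs hys hxy
  have h10 := hganti hxt hyt hxy
  rw [hxe, hye] at h10
  exact lt_asymm h9 h10

/-- A transition between distinct points cannot reverse the orientation. -/
theorem IsTransition.not_strictAntiOn (hf : ∀ x, AnalyticAt ℝ f x)
    (hinj : ∀ x, ∃ s ∈ 𝓝 x, InjOn f s) {h : ℝ → ℝ} (H : IsTransition f h a b)
    {s : Set ℝ} (hs : s ∈ 𝓝 a) : ¬ StrictAntiOn h s := by
  intro hanti
  set I : Set ℝ := uIcc a b with hI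
  have hK : IsCompact ((I ×ˢ I) ∩
      {p : ℝ × ℝ | ∃ h, IsTransition f h p.1 p.2 ∧ ∃ s ∈ 𝓝 p.1, StrictAntiOn h s}) :=
    (isCompact_uIcc.prod isCompact_uIcc).inter_right
      (isClosed_setOf_isTransition_strictAntiOn hf hinj)
  obtain ⟨⟨x, z⟩, ⟨⟨hxI, hzI⟩, g, G, t, ht, hg⟩, hmin⟩ :=
    hK.exists_isMinOn ⟨(a, b), ⟨left_mem_uIcc, right_mem_uIcc⟩, h, H, s, hs, hanti⟩
      (f := fun p => |p.1 - p.2|) (by fun_prop)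
  simp only [] at hxI hzI G ht
  have hxt := mem_of_mem_nhds ht
  have hmin' : ∀ᶠ y in 𝓝 x, y ∈ t ∧ (y ∈ I → g y ∈ I → |x - z| ≤ |y - g y|) := by
    filter_upwards [G.eventually, eventually_eventually_nhds.mpr (eventually_mem_set.mpr ht), ht]
      with y h1 h2 h3
    exact ⟨h3, fun h4 h5 => isMinOn_iff.mp hmin (y, g y) ⟨⟨h4, h5⟩, g, h1, t, h2, hg⟩⟩
  rcases lt_trichotomy x z with hxz | hxz | hxz
  · have e1 : ∀ᶠ y in 𝓝 x, y < (x + z) / 2 := eventually_lt_nhds (by linarith)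
    have e2 : ∀ᶠ y in 𝓝 x, (x + z) / 2 < g y := G.tendsto.eventually_const_lt (by linarith)
    obtain ⟨y, ⟨⟨hyt, hy⟩, h1, h2⟩, hxy⟩ :=
      (((hmin'.and (e1.and e2)).filter_mono nhdsWithin_le_nhds).and
        (self_mem_nhdsWithin (a := x) (s := Ioi x))).exists
    have hxy : x < y := hxy
    have h3 := hg hxt hyt hxy
    rw [G.map_self] at h3
    have h4 := hy (uIcc_subset_uIcc hxI hzI (by rw [uIcc_of_le hxz.le]; constructor <;> linarith))
      (uIcc_subset_uIcc hxI hzI (by rw [uIcc_of_le hxz.le]; constructor <;> linarith))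
    rw [abs_of_neg (by linarith), abs_of_neg (by linarith)] at h4
    linarith
  · subst hxz
    obtain ⟨V, hV, hVinj⟩ := hinj x
    have e1 : ∀ᶠ y in 𝓝 x, y ∈ t ∧ g y = y := by
      filter_upwards [ht, hV, G.tendsto.eventually_mem hV, G.comp_eq] with y h1 h2 h3 h4
      exact ⟨h1, hVinj h3 h2 h4⟩
    obtain ⟨y, ⟨hyt, hy⟩, hxy⟩ := ((e1.filter_mono nhdsWithin_le_nhds).and
        (self_mem_nhdsWithin (a := x) (s := Ioi x))).exists
    have h3 := hg hxt hyt hxy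
    rw [G.map_self, hy] at h3
    exact lt_asymm h3 hxy
  · have e1 : ∀ᶠ y in 𝓝 x, (x + z) / 2 < y := eventually_gt_nhds (by linarith)
    have e2 : ∀ᶠ y in 𝓝 x, g y < (x + z) / 2 := G.tendsto.eventually_lt_const (by linarith)
    obtain ⟨y, ⟨⟨hyt, hy⟩, h1, h2⟩, hxy⟩ :=
      (((hmin'.and (e1.and e2)).filter_mono nhdsWithin_le_nhds).and
        (self_mem_nhdsWithin (a := x) (s := Iio x))).exists
    have hxy : y < x := hxy
    have h3 := hg hyt hxt hxy
    rw [G.map_self] at h3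
    have h4 := hy (uIcc_subset_uIcc hxI hzI (by rw [uIcc_of_ge hxz.le]; constructor <;> linarith))
      (uIcc_subset_uIcc hxI hzI (by rw [uIcc_of_ge hxz.le]; constructor <;> linarith))
    rw [abs_of_pos (by linarith), abs_of_pos (by linarith)] at h4
    linarith

theorem IsTransition.exists_strictMonoOn (hf : ∀ x, AnalyticAt ℝ f x)
    (hinj : ∀ x, ∃ s ∈ 𝓝 x, InjOn f s) {h : ℝ → ℝ} (H : IsTransition f h a b) :
    ∃ s ∈ 𝓝 a, StrictMonoOn h s := by
  obtain ⟨s, hs, hmono | hanti⟩ := H.strictMonoOn_or_strictAntiOn (hinj a)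
  · exact ⟨s, hs, hmono⟩
  · exact absurd hanti (H.not_strictAntiOn hf hinj hs)

theorem eventually_exists_isTransition_mem_Icc (hf : ∀ x, AnalyticAt ℝ f x)
    (hinj : ∀ x, ∃ s ∈ 𝓝 x, InjOn f s) {h g : ℝ → ℝ} (hab : a < b) (H : IsTransition f h a b)
    (G : IsTransition f g b a) {x : ℝ} (hx : x ∈ Icc a b) :
    ∀ᶠ y in 𝓝 x, ∃ z ∈ Icc a b, ∃ k, IsTransition f k y z := by
  rcases eq_or_lt_of_le hx.1 with rfl | hax
  · obtain ⟨s, hs, hmono⟩ := H.exists_strictMonoOn hf hinj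
    filter_upwards [hs, H.eventually, H.tendsto.eventually_const_lt hab, eventually_lt_nhds hab]
      with y h1 h2 h3 h4
    rcases le_or_gt a y with hy | hy
    · exact ⟨y, ⟨hy, h4.le⟩, id, isTransition_id f y⟩
    · exact ⟨h y, ⟨h3.le, ((hmono h1 (mem_of_mem_nhds hs) hy).trans_eq H.map_self).le⟩, h, h2⟩
  rcases eq_or_lt_of_le hx.2 with rfl | hxb
  · obtain ⟨s, hs, hmono⟩ := G.exists_strictMonoOn hf hinj
    filter_upwards [hs, G.eventually, G.tendsto.eventually_lt_const hab, eventually_gt_nhds hab]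
      with y h1 h2 h3 h4
    rcases le_or_gt y x with hy | hy
    · exact ⟨y, ⟨h4.le, hy⟩, id, isTransition_id f y⟩
    · exact ⟨g y, ⟨(G.map_self.symm.trans_lt (hmono (mem_of_mem_nhds hs) h1 hy)).le, h3.le⟩, g, h2⟩
  · filter_upwards [Icc_mem_nhds hax hxb] with y hy using ⟨y, hy, id, isTransition_id f y⟩

theorem range_eq_image_Icc_of_isTransition (hf : ∀ x, AnalyticAt ℝ f x)
    (hinj : ∀ x, ∃ s ∈ 𝓝 x, InjOn f s) {h g : ℝ → ℝ} (hab : a < b) (H : IsTransition f h a b)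
    (G : IsTransition f g b a) : range f = f '' Icc a b := by
  set A : Set ℝ := {y | ∃ z ∈ Icc a b, ∃ k, IsTransition f k y z} with hA
  have hopen : IsOpen A := by
    rw [isOpen_iff_eventually]
    rintro y ⟨z, hz, k, K⟩
    filter_upwards [K.eventually, K.tendsto.eventually
      (eventually_exists_isTransition_mem_Icc hf hinj hab H G hz)] with x hx ⟨w, hw, l, L⟩
    exact ⟨w, hw, l ∘ k, L.comp hx⟩
  have hclosed : IsClosed A := by
    refine isClosed_of_closure_subset fun y hy => ?_
    obtain ⟨u, hu, huy⟩ := mem_closure_iff_seq_limit.mp hy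
    choose v hv k hk using hu
    obtain ⟨z, hz, φ, hφ, hvz⟩ := isCompact_Icc.tendsto_subseq hv
    exact ⟨z, hz, (isClosed_setOf_isTransition hf hinj).mem_of_tendsto
      ((huy.comp hφ.tendsto_atTop).prodMk_nhds hvz)
      (Eventually.of_forall fun n => ⟨k (φ n), hk (φ n)⟩)⟩
  have huniv : A = univ := IsClopen.eq_univ ⟨hclosed, hopen⟩
    ⟨a, a, left_mem_Icc.mpr hab.le, id, isTransition_id f a⟩
  refine Subset.antisymm ?_ (image_subset_range _ _)
  rintro _ ⟨y, rfl⟩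
  obtain ⟨z, hz, k, K⟩ : y ∈ A := huniv ▸ mem_univ y
  exact ⟨z, hz, K.apply_eq.symm⟩

theorem image_eq_loop_of_immediate_predecessor
    (F : ℂ → ℂ) (U : Set ℂ) (hU : IsOpen U) (hRU : ∀ x : ℝ, (x : ℂ) ∈ U)
    (hF : AnalyticOnNhd ℂ F U)
    (hinj : ∀ a : ℝ, ∃ ε > (0:ℝ),
      Set.InjOn (fun t : ℝ => F t) (Ioo (a - ε) (a + ε)))
    (S : Set (ℝ × ℝ)) (hS : S = {p | p.1 ≠ p.2 ∧ F p.1 = F p.2})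
    (γ δ : ℝ) (hγδ : γ < δ) (hlim : (γ, δ) ∈ closure (S \ {(γ, δ)}))
    (hpred : ¬ ∃ c ∈ Ioo γ δ, (γ, c) ∈ closure (S \ {(γ, c)})) :
    range (fun t : ℝ => F t) = (fun t : ℝ => F t) '' Icc γ δ ∧
      F (γ : ℝ) = F (δ : ℝ) := by
  have hf : ∀ x : ℝ, AnalyticAt ℝ (fun t : ℝ => F t) x := fun x =>
    AnalyticAt.fun_comp (f := fun t : ℝ => (t : ℂ)) (hF x (hRU x)).restrictScalars
      (Complex.ofRealCLM.analyticAt x)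
  have hinj' : ∀ x : ℝ, ∃ s ∈ 𝓝 x, InjOn (fun t : ℝ => F t) s := by
    intro x
    obtain ⟨ε, hε, h⟩ := hinj x
    exact ⟨_, Ioo_mem_nhds (by linarith) (by linarith), h⟩
  have hfr : ∃ᶠ p : ℝ × ℝ in 𝓝[≠] (γ, δ), F p.1 = F p.2 := by
    rw [frequently_nhdsWithin_iff]
    refine (mem_closure_iff_frequently.mp hlim).mono fun p hp => ⟨?_, hp.2⟩
    have := hp.1
    rw [hS] at this
    exact this.2
  have hswap : Tendsto Prod.swap (𝓝[≠] (γ, δ)) (𝓝[≠] (δ, γ)) :=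
    tendsto_nhdsWithin_of_tendsto_nhds_of_eventually_within _
      ((continuous_swap.tendsto (γ, δ)).mono_left nhdsWithin_le_nhds)
      (eventually_nhdsWithin_of_forall fun p hp hp' => hp (by
        rw [← Prod.swap_swap p, mem_singleton_iff.mp hp']; rfl))
  obtain ⟨h, H⟩ := exists_isTransition_of_frequently_eq hf hinj' hfr
  obtain ⟨g, G⟩ := exists_isTransition_of_frequently_eq hf hinj'
    (hswap.frequently (p := fun p : ℝ × ℝ => F p.1 = F p.2) (hfr.mono fun p hp => hp.symm))
  exact ⟨range_eq_image_Icc_of_isTransition hf hinj' hγδ H G, H.apply_eq⟩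
end
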